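/- arXiv:1407.2321 — 3 statements merged into one kernel-verified Lean document; each statement's English description precedes it below -/
import Mathlib

section
/- Let Λ be an artinian ring with Jacobson radical J, and suppose there exists a right Λ-module T of finite syzygy type s such that Λ/J, viewed as a right Λ-module, embeds into T. Then l Fin dim Λ ≤ rep(T) ≤ s. -/
open CategoryTheory

universe u

section Preamble

variable (R : Type u) [Ring R]

/-- `PdimLE R n M` : the left `R`-module `M` has projective dimension at most `n`,
i.e. it admits a projective resolution of length at most `n`. -/
def PdimLE : ℕ → ModuleCat.{u} R → Prop
  | 0, M => Module.Projective R M
  | n + 1, M =>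
    ∃ (P : ModuleCat.{u} R) (f : ↥P →ₗ[R] ↥M),
      Module.Projective R ↥P ∧ Function.Surjective f ∧
        PdimLE n (ModuleCat.of R (LinearMap.ker f))

/-- `M` has projective dimension exactly `d`. -/
def PdimEq (M : ModuleCat.{u} R) (d : ℕ) : Prop :=
  PdimLE R d M ∧ ∀ k, PdimLE R k M → d ≤ k

/-- The projective dimension of `M`, as an element of `ℕ∞` (`⊤` = infinite). -/
noncomputable def pdim (M : ModuleCat.{u} R) : ℕ∞ :=
  sInf {d : ℕ∞ | ∃ n : ℕ, d = n ∧ PdimLE R n M}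

/-- `IdimLE R n M` : the left `R`-module `M` has injective dimension at most `n`. -/
def IdimLE : ℕ → ModuleCat.{u} R → Prop
  | 0, M => Module.Injective R M
  | n + 1, M =>
    ∃ (E : ModuleCat.{u} R) (f : ↥M →ₗ[R] ↥E),
      Module.Injective R ↥E ∧ Function.Injective f ∧
        IdimLE n (ModuleCat.of R (↥E ⧸ LinearMap.range f))

/-- The injective dimension of `M`, as an element of `ℕ∞`. -/
noncomputable def idim (M : ModuleCat.{u} R) : ℕ∞ :=
  sInf {d : ℕ∞ | ∃ n : ℕ, d = n ∧ IdimLE R n M}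

/-- The (left) big finitistic dimension of `R`: the supremum of the projective
dimensions of all (left) `R`-modules of finite projective dimension. -/
noncomputable def bigFinDim : ℕ∞ :=
  sSup {d : ℕ∞ | d ≠ ⊤ ∧ ∃ M : ModuleCat.{u} R, pdim R M = d}

/-- The (left) little finitistic dimension of `R`: the supremum of the projective
dimensions of all finitely generated (left) `R`-modules of finite projective dimension. -/
noncomputable def littleFinDim : ℕ∞ :=
  sSup {d : ℕ∞ | d ≠ ⊤ ∧ ∃ M : ModuleCat.{u} R, Module.Finite R ↥M ∧ pdim R M = d}

/-- The (left) global dimension of `R`, as an element of `ℕ∞`. -/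
noncomputable def glDim : ℕ∞ :=
  sInf {d : ℕ∞ | ∃ n : ℕ, d = n ∧ ∀ M : ModuleCat.{u} R, PdimLE R n M}

/-- `A` is (isomorphic to) a direct summand of `B`. -/
def IsSummand (A B : ModuleCat.{u} R) : Prop :=
  ∃ C : ModuleCat.{u} R, Nonempty ((↥A × ↥C) ≃ₗ[R] ↥B)

/-- A minimal projective resolution of `M`, recorded through its syzygies:
`Ω 0 ≅ M`, and for each `n` the map `f n : P n → Ω n` is a projective cover
(i.e. `P n` is projective, `f n` is surjective and its kernel is superfluous in `P n`),
with `Ω (n+1) ≅ ker (f n)`. -/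
structure SyzygyChain (M : ModuleCat.{u} R) : Type (u + 1) where
  Ω : ℕ → ModuleCat.{u} R
  P : ℕ → ModuleCat.{u} R
  projective : ∀ n, Module.Projective R ↥(P n)
  f : ∀ n, ↥(P n) →ₗ[R] ↥(Ω n)
  surj : ∀ n, Function.Surjective (f n)
  minimal : ∀ n, ∀ N : Submodule R ↥(P n), N ⊔ LinearMap.ker (f n) = ⊤ → N = ⊤
  iso0 : Nonempty (↥(Ω 0) ≃ₗ[R] ↥M)
  isoSucc : ∀ n, Nonempty (↥(Ω (n + 1)) ≃ₗ[R] ↥(LinearMap.ker (f n)))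

/-- The minimal projective resolution is repetitive at degree `k`: the `k`-th
syzygy decomposes as `P ⊕ ⨁ᵢ Aᵢ` with `P` projective and each `Aᵢ` a direct summand
of infinitely many syzygies. -/
def RepAt {M : ModuleCat.{u} R} (c : SyzygyChain R M) (k : ℕ) : Prop :=
  ∃ (ι : Type u) (A : ι → ModuleCat.{u} R) (P : ModuleCat.{u} R),
    Module.Projective R ↥P ∧
    (∀ i, {j : ℕ | IsSummand R (A i) (c.Ω j)}.Infinite) ∧
    Nonempty (↥(c.Ω k) ≃ₗ[R] (↥P × DirectSum ι fun i => ↥(A i)))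

/-- The repetition index of a module (with a given minimal projective resolution),
as an element of `ℕ∞`. -/
noncomputable def repIndex {M : ModuleCat.{u} R} (c : SyzygyChain R M) : ℕ∞ :=
  sInf {d : ℕ∞ | ∃ k : ℕ, d = k ∧ RepAt R c k}

/-- The (left) global repetition index of `R`. -/
noncomputable def glRep : ℕ∞ :=
  sSup {d : ℕ∞ | ∃ (M : ModuleCat.{u} R) (c : SyzygyChain R M), repIndex R c = d}

/-- The syzygy category of `M` (given a minimal projective resolution `c` of `M`)
is a Krull-Schmidt category of finite representation type, with the `s` modules
`A 0, …, A (s-1)` as representatives of the isomorphism classes of its nonzero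
indecomposable objects: the `A i` have local endomorphism rings, are pairwise
non-isomorphic, each occurs as a direct summand of some syzygy, and every syzygy
is a finite direct sum of copies of the `A i`. -/
def HasSyzygyType {M : ModuleCat.{u} R} (c : SyzygyChain R M) (s : ℕ)
    (A : Fin s → ModuleCat.{u} R) : Prop :=
  (∀ i, IsLocalRing (Module.End R ↥(A i))) ∧
  (∀ i j : Fin s, i ≠ j → IsEmpty (↥(A i) ≃ₗ[R] ↥(A j))) ∧
  (∀ i, ∃ j, IsSummand R (A i) (c.Ω j)) ∧
  (∀ j, ∃ m : Fin s → ℕ, Nonempty (↥(c.Ω j) ≃ₗ[R] ((i : Fin s) → Fin (m i) → ↥(A i))))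

/-- Truncating a minimal projective resolution of `M` gives a minimal projective
resolution of the `m`-th syzygy of `M`. -/
def SyzygyChain.shift {M : ModuleCat.{u} R} (c : SyzygyChain R M) (m : ℕ) :
    SyzygyChain R (c.Ω m) where
  Ω := fun j => c.Ω (m + j)
  P := fun j => c.P (m + j)
  projective := fun j => c.projective (m + j)
  f := fun j => c.f (m + j)
  surj := fun j => c.surj (m + j)
  minimal := fun j => c.minimal (m + j)
  iso0 := ⟨LinearEquiv.refl R ↥(c.Ω (m + 0))⟩
  isoSucc := fun j => c.isoSucc (m + j)

/-- The radical (Jacobson radical) of `R` as a left module over itself: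
the intersection of all maximal submodules. -/
def ringRadical : Submodule R R := sInf {m : Submodule R R | IsCoatom m}

/-- `R / rad R` as a left `R`-module. -/
noncomputable abbrev radQuot : ModuleCat.{u} R := ModuleCat.of R (R ⧸ ringRadical R)

/-- `X` embeds into `T`. -/
def EmbedsIn (X T : ModuleCat.{u} R) : Prop := ∃ g : ↥X →ₗ[R] ↥T, Function.Injective g

/-- The homological contingency of `A` to `M` (with minimal projective resolution `c`)
equals the integer `z`: `z` is the greatest element of `{-1} ∪ {j | A is a direct
summand of Ω^j(M)}`.  (So `z = -1` iff `A` is a summand of no syzygy, and no such `z`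
exists iff the contingency is infinite.) -/
def ContEq {M : ModuleCat.{u} R} (c : SyzygyChain R M) (A : ModuleCat.{u} R) (z : ℤ) : Prop :=
  IsGreatest (insert (-1) ((fun j : ℕ => (j : ℤ)) '' {j | IsSummand R A (c.Ω j)})) z

/-- `E` is an injective envelope of `X`: `E` is injective and contains a copy of `X`
as an essential submodule. -/
def IsInjectiveEnvelopeOf (X E : ModuleCat.{u} R) : Prop :=
  ∃ f : ↥X →ₗ[R] ↥E, Module.Injective R ↥E ∧ Function.Injective f ∧
    ∀ N : Submodule R ↥E, N ≠ ⊥ → N ⊓ LinearMap.range f ≠ ⊥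

end Preamble

namespace LinearMap

variable {R : Type*} [Ring R] {K Q N E I F : Type*}
  [AddCommGroup K] [AddCommGroup Q] [AddCommGroup N] [Module R K] [Module R Q] [Module R N]
  [AddCommGroup E] [AddCommGroup I] [AddCommGroup F] [Module R E] [Module R I] [Module R F]

theorem exists_comp_eq_of_exact_of_injective {a : E →ₗ[R] I} {b : I →ₗ[R] F}
    (ha : Function.Injective a) (hab : Function.Exact a b) (g : N →ₗ[R] I) (hg : b ∘ₗ g = 0) :
    ∃ h : N →ₗ[R] E, a ∘ₗ h = g := by
  have hmem (x : N) : g x ∈ range a := (hab (g x)).1 (LinearMap.congr_fun hg x)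
  refine ⟨(LinearEquiv.ofInjective a ha).symm ∘ₗ g.codRestrict (range a) hmem, ?_⟩
  ext x
  simp

theorem exists_comp_eq_of_exact_of_surjective {i : K →ₗ[R] Q} {p : Q →ₗ[R] N}
    (hp : Function.Surjective p) (hip : Function.Exact i p) (g : Q →ₗ[R] I) (hg : g ∘ₗ i = 0) :
    ∃ h : N →ₗ[R] I, h ∘ₗ p = g := by
  have hker : ker p ≤ ker g := by
    intro x hx
    obtain ⟨y, rfl⟩ := (hip x).1 hx
    exact LinearMap.congr_fun hg y
  refine ⟨(ker p).liftQ g hker ∘ₗ (p.quotKerEquivOfSurjective hp).symm.toLinearMap, ?_⟩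
  ext x
  have : (p.quotKerEquivOfSurjective hp).symm (p x) = (ker p).mkQ x := by
    rw [LinearEquiv.symm_apply_eq]; rfl
  simp [this]

/-- Every linear map `K → E` extends along `i : K → Q`. -/
def Extends (i : K →ₗ[R] Q) (E : Type*) [AddCommGroup E] [Module R E] : Prop :=
  ∀ h : K →ₗ[R] E, ∃ H : Q →ₗ[R] E, H ∘ₗ i = h

theorem Extends.of_retract {i : K →ₗ[R] Q} (h : Extends i I) (u : E →ₗ[R] I) (v : I →ₗ[R] E)
    (huv : v ∘ₗ u = id) : Extends i E := fun g ↦ by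
  obtain ⟨H, hH⟩ := h (u ∘ₗ g)
  exact ⟨v ∘ₗ H, by rw [comp_assoc, hH, ← comp_assoc, huv, id_comp]⟩

theorem Extends.pi {i : K →ₗ[R] Q} {ι : Type*} {E : ι → Type*} [∀ j, AddCommGroup (E j)]
    [∀ j, Module R (E j)] (h : ∀ j, Extends i (E j)) : Extends i (∀ j, E j) := fun g ↦ by
  choose H hH using fun j ↦ h j (proj j ∘ₗ g)
  refine ⟨LinearMap.pi H, ?_⟩
  ext x j
  exact LinearMap.congr_fun (hH j) x

theorem Extends.prod {i : K →ₗ[R] Q} (hE : Extends i E) (hI : Extends i I) :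
    Extends i (E × I) := fun g ↦ by
  obtain ⟨H, hH⟩ := hE (fst R E I ∘ₗ g)
  obtain ⟨H', hH'⟩ := hI (snd R E I ∘ₗ g)
  refine ⟨H.prod H', ?_⟩
  ext x
  · exact LinearMap.congr_fun hH x
  · exact LinearMap.congr_fun hH' x

theorem extends_of_projective {i : K →ₗ[R] Q} {p : Q →ₗ[R] N} (hi : Function.Injective i)
    (hp : Function.Surjective p) (hip : Function.Exact i p) [Module.Projective R N] :
    Extends i E := fun g ↦ by
  obtain ⟨s, hs⟩ := Module.projective_lifting_property p LinearMap.id hp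
  obtain ⟨r, hr⟩ := exists_comp_eq_of_exact_of_injective hi hip (LinearMap.id - s ∘ₗ p) (by
    rw [comp_sub, ← comp_assoc, hs]; simp)
  refine ⟨g ∘ₗ r, ?_⟩
  ext x
  have h := LinearMap.congr_fun hr (i x)
  have h0 : p (i x) = 0 := (hip _).2 ⟨x, rfl⟩
  simp only [coe_comp, Function.comp_apply, sub_apply, id_coe, id_eq, h0, map_zero, sub_zero] at h
  simp [hi h]

/-- Dimension shifting: the vanishing of `Ext` in the second variable `E` at the second step of a
projective resolution amounts to its vanishing in the cosyzygy `F` at the first step. -/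
theorem extends_shift_iff {L Q' : Type*} [AddCommGroup L] [AddCommGroup Q'] [Module R L]
    [Module R Q'] [Module.Projective R Q] [Module.Projective R Q']
    {i₀ : K →ₗ[R] Q} {i₁ : L →ₗ[R] Q'} {p₁ : Q' →ₗ[R] K}
    (hp₁ : Function.Surjective p₁) (hip : Function.Exact i₁ p₁)
    {a : E →ₗ[R] I} {b : I →ₗ[R] F} (ha : Function.Injective a) (hb : Function.Surjective b)
    (hab : Function.Exact a b) (hI₀ : Extends i₀ I) (hI₁ : Extends i₁ I) :
    Extends i₁ E ↔ Extends i₀ F := by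
  have hpi : p₁ ∘ₗ i₁ = 0 := hip.linearMap_comp_eq_zero
  have hba : b ∘ₗ a = 0 := hab.linearMap_comp_eq_zero
  constructor
  · intro h g
    obtain ⟨φ, hφ⟩ := Module.projective_lifting_property b (g ∘ₗ p₁) hb
    obtain ⟨e, he⟩ := exists_comp_eq_of_exact_of_injective ha hab (φ ∘ₗ i₁) (by
      rw [← comp_assoc, hφ, comp_assoc, hpi, comp_zero])
    obtain ⟨e', he'⟩ := h e
    obtain ⟨ψ, hψ⟩ := exists_comp_eq_of_exact_of_surjective hp₁ hip (φ - a ∘ₗ e') (by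
      rw [sub_comp, comp_assoc, he', he, sub_self])
    obtain ⟨Ψ, hΨ⟩ := hI₀ ψ
    refine ⟨b ∘ₗ Ψ, ?_⟩
    rw [comp_assoc, hΨ, ← cancel_right hp₁, comp_assoc, hψ, comp_sub, hφ, ← comp_assoc, hba]
    simp
  · intro h g
    obtain ⟨φ, hφ⟩ := hI₁ (a ∘ₗ g)
    obtain ⟨f, hf⟩ := exists_comp_eq_of_exact_of_surjective hp₁ hip (b ∘ₗ φ) (by
      rw [comp_assoc, hφ, ← comp_assoc, hba, zero_comp])
    obtain ⟨f', hf'⟩ := h f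
    obtain ⟨ψ, hψ⟩ := Module.projective_lifting_property b f' hb
    obtain ⟨e, he⟩ := exists_comp_eq_of_exact_of_injective ha hab (φ - ψ ∘ₗ i₀ ∘ₗ p₁) (by
      rw [comp_sub, ← comp_assoc, hψ, ← comp_assoc, hf', hf, sub_self])
    refine ⟨e, ?_⟩
    rw [← cancel_left ha, ← comp_assoc, he, sub_comp, hφ, comp_assoc, comp_assoc, hpi]
    simp

end LinearMap

open MulOpposite in
theorem Ring.unop_mem_jacobson {R S : Type*} [Ring R] [Ring S] [IsArtinianRing R]
    (e : R ≃+* Sᵐᵒᵖ) {x : R} (hx : x ∈ Ring.jacobson R) : unop (e x) ∈ Ring.jacobson S := by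
  rw [← Ideal.jacobson_bot, Ideal.mem_jacobson_iff]
  intro y
  have hmem : -(x * e.symm (op y)) ∈ Ring.jacobson R :=
    neg_mem (Ideal.IsTwoSided.mul_mem_of_left _ hx)
  obtain ⟨n, hn⟩ := IsSemiprimaryRing.isNilpotent (R := R)
  have hnil : IsNilpotent (-(x * e.symm (op y))) := ⟨n, by
    have := Ideal.pow_mem_pow hmem n
    rwa [hn] at this⟩
  obtain ⟨u, hu⟩ := hnil.isUnit_one_sub
  refine ⟨unop (e ↑u⁻¹), ?_⟩
  have h1 : (1 - -(x * e.symm (op y))) * ↑u⁻¹ = 1 := by rw [← hu]; simp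
  have h2 := congrArg (fun z ↦ unop (e z)) h1
  simp only [map_mul, unop_mul, map_sub, map_one, MulOpposite.unop_sub, unop_one, map_neg,
    MulOpposite.unop_neg, RingEquiv.apply_symm_apply, unop_op] at h2
  rw [Ideal.mem_bot, ← sub_eq_zero.2 h2]
  noncomm_ring

/-- The left module of characters of a right module. -/
def OpDual (X : Type*) [AddCommGroup X] : Type _ := X →+ AddCircle (1 : ℚ)

namespace OpDual

open MulOpposite

variable {R : Type*} [Ring R] {X Y Z : Type*} [AddCommGroup X] [AddCommGroup Y] [AddCommGroup Z]
  [Module Rᵐᵒᵖ X] [Module Rᵐᵒᵖ Y] [Module Rᵐᵒᵖ Z]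

instance : AddCommGroup (OpDual X) := inferInstanceAs (AddCommGroup (X →+ _))

instance : FunLike (OpDual X) X (AddCircle (1 : ℚ)) :=
  inferInstanceAs (FunLike (X →+ _) X _)

instance : AddMonoidHomClass (OpDual X) X (AddCircle (1 : ℚ)) :=
  inferInstanceAs (AddMonoidHomClass (X →+ _) X _)

@[ext] theorem ext {f g : OpDual X} (h : ∀ x, f x = g x) : f = g := DFunLike.ext _ _ h

@[simp] theorem add_apply (f g : OpDual X) (x : X) : (f + g) x = f x + g x := rfl

@[simp] theorem zero_apply (x : X) : (0 : OpDual X) x = 0 := rfl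

instance : SMul R (OpDual X) where
  smul r f := AddMonoidHom.comp f (DistribSMul.toAddMonoidHom X (op r))

@[simp] theorem smul_apply (r : R) (f : OpDual X) (x : X) : (r • f) x = f (op r • x) := rfl

instance : Module R (OpDual X) where
  one_smul f := by ext; simp
  mul_smul r s f := by ext; simp [mul_smul]
  smul_zero r := by ext; simp
  smul_add r f g := by ext; simp
  add_smul r s f := by ext; simp [add_smul]
  zero_smul f := by ext; simp

/-- The transpose of a map of right modules. -/
def map (g : X →ₗ[Rᵐᵒᵖ] Y) : OpDual Y →ₗ[R] OpDual X where
  toFun φ := AddMonoidHom.comp φ g.toAddMonoidHom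
  map_add' _ _ := rfl
  map_smul' r φ := by
    ext x
    exact congrArg φ (g.map_smul (op r) x).symm

@[simp] theorem map_apply (g : X →ₗ[Rᵐᵒᵖ] Y) (φ : OpDual Y) (x : X) : map g φ x = φ (g x) := rfl

theorem map_comp_map_eq_id {g : X →ₗ[Rᵐᵒᵖ] Y} {h : Y →ₗ[Rᵐᵒᵖ] X} (hg : h ∘ₗ g = LinearMap.id) :
    map g ∘ₗ map h = (LinearMap.id : OpDual X →ₗ[R] OpDual X) := by
  ext φ x
  exact congrArg φ (LinearMap.congr_fun hg x)

theorem map_injective {g : X →ₗ[Rᵐᵒᵖ] Y} (hg : Function.Surjective g) :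
    Function.Injective (map g) := fun φ ψ h ↦ by
  ext y
  obtain ⟨x, rfl⟩ := hg y
  exact DFunLike.congr_fun h x

theorem map_surjective {g : X →ₗ[Rᵐᵒᵖ] Y} (hg : Function.Injective g) :
    Function.Surjective (map g) := fun φ ↦ by
  obtain ⟨ψ, hψ⟩ := (Module.Baer.of_divisible _).extension_property_addMonoidHom
    g.toAddMonoidHom hg φ
  exact ⟨ψ, hψ⟩

theorem map_exact {g : X →ₗ[Rᵐᵒᵖ] Y} {h : Y →ₗ[Rᵐᵒᵖ] Z} (hh : Function.Surjective h)
    (hgh : Function.Exact g h) : Function.Exact (map h) (map g) := by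
  intro φ
  constructor
  · intro hφ
    refine ⟨h.toAddMonoidHom.liftOfRightInverse _ (Function.rightInverse_surjInv hh)
      ⟨φ, fun y hy ↦ ?_⟩, ?_⟩
    · obtain ⟨x, rfl⟩ := (hgh y).1 hy
      exact DFunLike.congr_fun hφ x
    · ext y
      exact h.toAddMonoidHom.liftOfRightInverse_comp_apply _ (Function.rightInverse_surjInv hh) _ y
  · rintro ⟨ψ, rfl⟩
    ext x
    simp [(hgh (g x)).2 ⟨x, rfl⟩]

/-- Characters of a direct sum are families of characters. -/
def ofPi {ι : Type*} [DecidableEq ι] (A : ι → Type*) [∀ i, AddCommGroup (A i)]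
    [∀ i, Module Rᵐᵒᵖ (A i)] : (∀ i, OpDual (A i)) →ₗ[R] OpDual (DirectSum ι A) where
  toFun φ := DirectSum.toAddMonoid fun i ↦ (φ i : A i →+ AddCircle (1 : ℚ))
  map_add' φ ψ := DirectSum.addHom_ext fun i x ↦ by
    refine (DirectSum.toAddMonoid_of _ i x).trans (Eq.symm ?_)
    exact congrArg₂ (fun a b : AddCircle (1 : ℚ) ↦ a + b) (DirectSum.toAddMonoid_of _ i x)
      (DirectSum.toAddMonoid_of _ i x)
  map_smul' r φ := DirectSum.addHom_ext fun i x ↦ by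
    refine (DirectSum.toAddMonoid_of _ i x).trans (Eq.symm ?_)
    change DirectSum.toAddMonoid (fun i ↦ (φ i : A i →+ AddCircle (1 : ℚ)))
      (op r • DirectSum.lof Rᵐᵒᵖ ι A i x) = _
    rw [← map_smul]
    exact DirectSum.toAddMonoid_of _ i (op r • x)

variable {K Q : Type*} [AddCommGroup K] [AddCommGroup Q] [Module R K] [Module R Q]
  {i : K →ₗ[R] Q}

theorem extends_of_retract (h : LinearMap.Extends i (OpDual Y)) (u : X →ₗ[Rᵐᵒᵖ] Y)
    (v : Y →ₗ[Rᵐᵒᵖ] X) (huv : v ∘ₗ u = LinearMap.id) : LinearMap.Extends i (OpDual X) :=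
  h.of_retract (map v) (map u) (map_comp_map_eq_id huv)

theorem extends_directSum {ι : Type*} (A : ι → Type*) [∀ j, AddCommGroup (A j)]
    [∀ j, Module Rᵐᵒᵖ (A j)] (h : ∀ j, LinearMap.Extends i (OpDual (A j))) :
    LinearMap.Extends i (OpDual (DirectSum ι A)) := by
  classical
  refine (LinearMap.Extends.pi h).of_retract
    (LinearMap.pi fun j ↦ map (DirectSum.lof Rᵐᵒᵖ ι A j)) (ofPi A) ?_
  ext1 φ
  exact DirectSum.addHom_ext fun j x ↦ DirectSum.toAddMonoid_of _ j x

theorem extends_prod (hX : LinearMap.Extends i (OpDual X)) (hY : LinearMap.Extends i (OpDual Y)) :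
    LinearMap.Extends i (OpDual (X × Y)) := by
  refine (hX.prod hY).of_retract
    ((map (LinearMap.inl Rᵐᵒᵖ X Y)).prod (map (LinearMap.inr Rᵐᵒᵖ X Y)))
    ((map (LinearMap.fst Rᵐᵒᵖ X Y)).coprod (map (LinearMap.snd Rᵐᵒᵖ X Y))) ?_
  ext φ x
  obtain ⟨x, y⟩ := x
  change φ (x, 0) + φ (0, y) = φ (x, y)
  rw [← map_add]
  simp

/-- The map `q ↦ (x ↦ χ (x q))` into the character module of the ring. -/
def ofCharacter (χ : Q →+ AddCircle (1 : ℚ)) : Q →ₗ[R] OpDual Rᵐᵒᵖ where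
  toFun q := χ.comp ((AddMonoidHom.flip (smulAddHom R Q) q).comp
    (opAddEquiv (α := R)).symm.toAddMonoidHom)
  map_add' q q' := by
    ext x
    change χ (unop x • (q + q')) = χ (unop x • q) + χ (unop x • q')
    simp
  map_smul' r q := by
    ext x
    change χ (unop x • (r • q)) = χ (unop (op r * x) • q)
    simp [mul_smul]

@[simp] theorem ofCharacter_apply (χ : Q →+ AddCircle (1 : ℚ)) (q : Q) (x : Rᵐᵒᵖ) :
    ofCharacter χ q x = χ (unop x • q) := rfl

theorem extends_self (hi : Function.Injective i) : LinearMap.Extends i (OpDual Rᵐᵒᵖ) := fun h ↦ by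
  let χ : K →+ AddCircle (1 : ℚ) :=
    { toFun := fun x ↦ h x 1, map_zero' := by simp, map_add' := by simp }
  obtain ⟨ψ, hψ⟩ := (Module.Baer.of_divisible _).extension_property_addMonoidHom
    i.toAddMonoidHom hi χ
  refine ⟨ofCharacter ψ, ?_⟩
  ext k x
  have := DFunLike.congr_fun hψ (unop x • k)
  change ψ (i (unop x • k)) = h (unop x • k) 1 at this
  simpa using this

theorem extends_of_projective (hi : Function.Injective i) [Module.Projective Rᵐᵒᵖ X] :
    LinearMap.Extends i (OpDual X) := by
  obtain ⟨s, hs⟩ := (Module.projective_def' (R := Rᵐᵒᵖ) (P := X)).1 inferInstance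
  classical
  let e := finsuppLEquivDirectSum Rᵐᵒᵖ Rᵐᵒᵖ X
  refine extends_of_retract (extends_directSum (fun _ : X ↦ Rᵐᵒᵖ) fun _ ↦ extends_self hi)
    (e.toLinearMap ∘ₗ s)
    (Finsupp.linearCombination Rᵐᵒᵖ (id : X → X) ∘ₗ e.symm.toLinearMap) ?_
  rw [← hs]
  ext x
  simp

end OpDual

section Detection

open MulOpposite

variable {R : Type u} [Ring R]

theorem isSemisimpleModule_of_jacobson_smul [IsArtinianRing R] {M : Type*} [AddCommGroup M] [Module R M]
    (h : Module.IsTorsionBySet R M (Ring.jacobson R)) : IsSemisimpleModule R M := by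
  let _ := h.module
  exact h.isSemisimpleModule_iff.1 inferInstance

theorem isTorsionBySet_opDual_radQuot [IsArtinianRing R] :
    Module.IsTorsionBySet R (OpDual (Rᵐᵒᵖ ⧸ ringRadical Rᵐᵒᵖ)) (Ring.jacobson R) := by
  intro f r
  ext x
  obtain ⟨x, rfl⟩ := Submodule.mkQ_surjective _ x
  have hr := Ring.unop_mem_jacobson (RingEquiv.opOp R) r.2
  have : op r.1 * x ∈ ringRadical Rᵐᵒᵖ :=
    Ideal.IsTwoSided.mul_mem_of_left (I := Ring.jacobson Rᵐᵒᵖ) x hr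
  change f ((ringRadical Rᵐᵒᵖ).mkQ (op r.1 * x)) = 0
  rw [Submodule.mkQ_apply, (Submodule.Quotient.mk_eq_zero _).2 this, map_zero]

theorem exists_radCharacter [IsArtinianRing Rᵐᵒᵖ] {V : Type*} [AddCommGroup V] [Module R V]
    (hV : Module.IsTorsionBySet R V (Ring.jacobson R)) (χ : CharacterModule V) :
    ∃ h : V →ₗ[R] OpDual (Rᵐᵒᵖ ⧸ ringRadical Rᵐᵒᵖ),
      OpDual.map (ringRadical Rᵐᵒᵖ).mkQ ∘ₗ h = OpDual.ofCharacter χ := by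
  refine LinearMap.exists_comp_eq_of_exact_of_injective
    (OpDual.map_injective (Submodule.mkQ_surjective _))
    (OpDual.map_exact (g := (ringRadical Rᵐᵒᵖ).subtype) (Submodule.mkQ_surjective _)
      (LinearMap.exact_subtype_mkQ _)) _ ?_
  ext v x
  have : unop x.1 • v = 0 :=
    hV (a := ⟨_, Ring.unop_mem_jacobson (RingEquiv.refl Rᵐᵒᵖ) x.2⟩) (x := v)
  change χ (unop x.1 • v) = 0
  rw [this, map_zero]

/-- A module annihilated by the radical is a direct summand of a power of the character module of
`R / rad R`. -/
theorem exists_retract_pi_opDual [IsArtinianRing R] [IsArtinianRing Rᵐᵒᵖ] {V : Type*}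
    [AddCommGroup V] [Module R V]
    (hV : Module.IsTorsionBySet R V (Ring.jacobson R)) :
    ∃ (e : V →ₗ[R] (CharacterModule V → OpDual (Rᵐᵒᵖ ⧸ ringRadical Rᵐᵒᵖ)))
      (r : (CharacterModule V → OpDual (Rᵐᵒᵖ ⧸ ringRadical Rᵐᵒᵖ)) →ₗ[R] V),
      r ∘ₗ e = LinearMap.id := by
  choose h hh using exists_radCharacter hV
  have hW : IsSemisimpleModule R (CharacterModule V → OpDual (Rᵐᵒᵖ ⧸ ringRadical Rᵐᵒᵖ)) :=
    isSemisimpleModule_of_jacobson_smul fun {f} {r} ↦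
      funext fun χ ↦ isTorsionBySet_opDual_radQuot (x := f χ) (a := r)
  have hinj : Function.Injective (LinearMap.pi h) := by
    rw [injective_iff_map_eq_zero]
    intro v hv
    refine CharacterModule.eq_zero_of_character_apply fun χ ↦ ?_
    have h1 := DFunLike.congr_fun (LinearMap.congr_fun (hh χ) v) 1
    have h2 : h χ v = 0 := congrFun hv χ
    rw [LinearMap.comp_apply, h2, map_zero] at h1
    change 0 = χ (unop (1 : Rᵐᵒᵖ) • v) at h1
    rw [h1, unop_one, one_smul]
  obtain ⟨r, hr⟩ := IsSemisimpleModule.extension_property (LinearMap.pi h) hinj LinearMap.id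
  exact ⟨_, r, hr⟩

theorem isUnit_of_range_sub_one_le_smul [IsArtinianRing R] {K : Type*} [AddCommGroup K]
    [Module R K] (g : Module.End R K) (hg : ∀ x, x - g x ∈ Ring.jacobson R • (⊤ : Submodule R K)) :
    IsUnit g := by
  have key (m : ℕ) (x : K) : ((1 - g) ^ m) x ∈ Ring.jacobson R ^ m • (⊤ : Submodule R K) := by
    induction m with
    | zero => rw [Submodule.pow_zero, Ideal.one_eq_top, Submodule.top_smul]; exact Submodule.mem_top
    | succ m ih =>
      rw [pow_succ', Module.End.mul_apply, Submodule.pow_succ, ← smul_eq_mul, Submodule.smul_assoc]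
      refine Submodule.smul_induction_on ih (fun r hr z _ ↦ ?_) fun y z hy hz ↦ ?_
      · rw [map_smul]
        exact Submodule.smul_mem_smul hr (hg z)
      · rw [map_add]
        exact add_mem hy hz
  obtain ⟨n, hn⟩ := IsSemiprimaryRing.isNilpotent (R := R)
  have hnil : IsNilpotent (1 - g) := ⟨n, by
    ext x
    have := key n x
    rw [hn] at this
    simpa using this⟩
  simpa using hnil.isUnit_one_sub

theorem projective_of_extends_radQuot [IsArtinianRing R] [IsArtinianRing Rᵐᵒᵖ]
    {K Q N : Type*} [AddCommGroup K]
    [AddCommGroup Q] [AddCommGroup N] [Module R K] [Module R Q] [Module R N] [Module.Projective R K]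
    [Module.Projective R Q] {i : K →ₗ[R] Q} {p : Q →ₗ[R] N}
    (hp : Function.Surjective p) (hip : Function.Exact i p)
    (h : LinearMap.Extends i (OpDual (Rᵐᵒᵖ ⧸ ringRadical Rᵐᵒᵖ))) : Module.Projective R N := by
  obtain ⟨e, r, hre⟩ := exists_retract_pi_opDual (R := R)
    (V := K ⧸ Ring.jacobson R • (⊤ : Submodule R K)) (by
      intro x a
      obtain ⟨x, rfl⟩ := Submodule.mkQ_surjective _ x
      rw [← map_smul, Submodule.mkQ_apply, Submodule.Quotient.mk_eq_zero]
      exact Submodule.smul_mem_smul a.2 Submodule.mem_top)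
  obtain ⟨φ, hφ⟩ := ((LinearMap.Extends.pi fun _ ↦ h).of_retract e r hre) (Submodule.mkQ _)
  obtain ⟨g, hg⟩ := Module.projective_lifting_property (Submodule.mkQ _) φ
    (Submodule.mkQ_surjective (Ring.jacobson R • (⊤ : Submodule R K)))
  obtain ⟨u, hu⟩ := isUnit_of_range_sub_one_le_smul (g ∘ₗ i) fun x ↦ by
    rw [← Submodule.Quotient.mk_eq_zero, Submodule.Quotient.mk_sub, sub_eq_zero]
    have h1 := LinearMap.congr_fun hφ x
    rw [← hg] at h1
    exact h1.symm
  have hr : ((↑u⁻¹ : Module.End R K) ∘ₗ g) ∘ₗ i = LinearMap.id := by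
    rw [LinearMap.comp_assoc, ← hu]
    exact u.inv_mul
  obtain ⟨s, hs⟩ := LinearMap.exists_comp_eq_of_exact_of_surjective hp hip
    (LinearMap.id - i ∘ₗ ((↑u⁻¹ : Module.End R K) ∘ₗ g)) (by
      rw [LinearMap.sub_comp, LinearMap.comp_assoc, hr]; simp)
  refine Module.Projective.of_split s p ?_
  rw [← LinearMap.cancel_right hp, LinearMap.comp_assoc, hs, LinearMap.comp_sub,
    ← LinearMap.comp_assoc, hip.linearMap_comp_eq_zero]
  simp

end Detection

/-- A projective resolution recorded through its syzygies `M n`. -/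
structure ProjResolution (R : Type u) [Ring R] where
  /-- the syzygies -/
  M : ℕ → ModuleCat.{u} R
  /-- the projective terms -/
  Q : ℕ → ModuleCat.{u} R
  projective : ∀ n, Module.Projective R (Q n)
  /-- the inclusion of a syzygy -/
  i : ∀ n, M (n + 1) →ₗ[R] Q n
  /-- the projection onto a syzygy -/
  p : ∀ n, Q n →ₗ[R] M n
  inj : ∀ n, Function.Injective (i n)
  surj : ∀ n, Function.Surjective (p n)
  exact : ∀ n, Function.Exact (i n) (p n)

namespace ProjResolution

variable {R : Type u} [Ring R]

/-- The projective resolution underlying a minimal one. -/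
noncomputable def ofSyzygyChain {M : ModuleCat.{u} R} (c : SyzygyChain R M) : ProjResolution R where
  M := c.Ω
  Q := c.P
  projective := c.projective
  i n := (LinearMap.ker (c.f n)).subtype ∘ₗ (c.isoSucc n).some.toLinearMap
  p := c.f
  inj n := Subtype.val_injective.comp (c.isoSucc n).some.injective
  surj := c.surj
  exact n := by
    rw [LinearMap.exact_iff, LinearMap.range_comp, LinearEquiv.range, Submodule.map_top,
      Submodule.range_subtype]

/-- The trivial resolution of a projective module. -/
def ofProjective (M : ModuleCat.{u} R) [Module.Projective R M] : ProjResolution R where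
  M n := Nat.casesOn n M fun _ ↦ ModuleCat.of R PUnit
  Q n := Nat.casesOn n M fun _ ↦ ModuleCat.of R PUnit
  projective n := by
    cases n
    · assumption
    · exact inferInstanceAs (Module.Projective R PUnit.{u + 1})
  i _ := 0
  p _ := LinearMap.id
  inj _ := Function.injective_of_subsingleton (α := PUnit) _
  surj _ := Function.surjective_id
  exact n x := by
    constructor
    · intro h
      exact ⟨0, h.symm⟩
    · rintro ⟨_, rfl⟩
      rfl

/-- Prolonging a resolution by one step. -/
def cons (r : ProjResolution R) {M P : ModuleCat.{u} R} (hP : Module.Projective R P)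
    (i : r.M 0 →ₗ[R] P) (p : P →ₗ[R] M) (hi : Function.Injective i) (hp : Function.Surjective p)
    (hip : Function.Exact i p) : ProjResolution R where
  M n := Nat.casesOn n M r.M
  Q n := Nat.casesOn n P r.Q
  projective n := Nat.casesOn n hP r.projective
  i n := Nat.casesOn n i r.i
  p n := Nat.casesOn n p r.p
  inj n := Nat.casesOn n hi r.inj
  surj n := Nat.casesOn n hp r.surj
  exact n := Nat.casesOn n hip r.exact

/-- Forgetting the first step of a resolution. -/
def tail (r : ProjResolution R) : ProjResolution R where
  M n := r.M (n + 1)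
  Q n := r.Q (n + 1)
  projective n := r.projective (n + 1)
  i n := r.i (n + 1)
  p n := r.p (n + 1)
  inj n := r.inj (n + 1)
  surj n := r.surj (n + 1)
  exact n := r.exact (n + 1)

end ProjResolution

theorem PdimLE.exists_resolution {R : Type u} [Ring R] {d : ℕ} {M : ModuleCat.{u} R}
    (h : PdimLE R d M) : ∃ r : ProjResolution R, Nonempty (r.M 0 ≃ₗ[R] M) ∧
      ∀ n, d ≤ n → Module.Projective R (r.M n) := by
  induction d generalizing M with
  | zero =>
    have : Module.Projective R M := h
    exact ⟨.ofProjective M, ⟨LinearEquiv.refl R M⟩,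
      fun n _ ↦ (ProjResolution.ofProjective M).projective n⟩
  | succ d ih =>
    obtain ⟨P, f, hP, hf, hk⟩ := h
    obtain ⟨r, ⟨e⟩, hr⟩ := ih hk
    refine ⟨r.cons hP ((LinearMap.ker f).subtype ∘ₗ e.toLinearMap) f
      (Subtype.val_injective.comp e.injective) hf ?_, ⟨LinearEquiv.refl R M⟩, ?_⟩
    · rw [LinearMap.exact_iff, LinearMap.range_comp, LinearEquiv.range, Submodule.map_top,
        Submodule.range_subtype]
    · rintro (_ | n) hn
      · omega
      · exact hr n (by omega)

theorem PdimLE.congr {R : Type u} [Ring R] {d : ℕ} {M N : ModuleCat.{u} R}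
    (h : PdimLE R d M) (e : M ≃ₗ[R] N) : PdimLE R d N := by
  cases d with
  | zero =>
    have : Module.Projective R M := h
    exact Module.Projective.of_equiv' e
  | succ d =>
    obtain ⟨P, f, hP, hf, hk⟩ := h
    refine ⟨P, e.toLinearMap ∘ₗ f, hP, e.surjective.comp hf, ?_⟩
    rwa [LinearEquiv.ker_comp]

theorem ProjResolution.pdimLE {R : Type u} [Ring R] {d : ℕ} (r : ProjResolution R)
    (h : Module.Projective R (r.M d)) : PdimLE R d (r.M 0) := by
  induction d generalizing r with
  | zero => exact h
  | succ d ih =>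
    refine ⟨r.Q 0, r.p 0, r.projective 0, r.surj 0, ?_⟩
    refine (ih r.tail h).congr ((LinearEquiv.ofInjective (r.i 0) (r.inj 0)).trans
      (LinearEquiv.ofEq _ _ ?_))
    exact ((LinearMap.exact_iff.1 (r.exact 0))).symm

section Repetition

variable {R : Type u} [Ring R]

theorem ProjResolution.extends_shift_iff (r : ProjResolution R) (t : ProjResolution Rᵐᵒᵖ)
    (n j : ℕ) : LinearMap.Extends (r.i (n + 1)) (OpDual (t.M j)) ↔
      LinearMap.Extends (r.i n) (OpDual (t.M (j + 1))) := by
  have := r.projective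
  have := t.projective
  exact LinearMap.extends_shift_iff (r.surj (n + 1)) (r.exact (n + 1))
    (OpDual.map_injective (t.surj j)) (OpDual.map_surjective (t.inj j))
    (OpDual.map_exact (t.surj j) (t.exact j)) (OpDual.extends_of_projective (r.inj n))
    (OpDual.extends_of_projective (r.inj (n + 1)))

theorem ProjResolution.extends_add_iff (r : ProjResolution R) (t : ProjResolution Rᵐᵒᵖ)
    (n j m : ℕ) : LinearMap.Extends (r.i (n + m)) (OpDual (t.M j)) ↔
      LinearMap.Extends (r.i n) (OpDual (t.M (j + m))) := by
  induction m generalizing j with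
  | zero => rfl
  | succ m ih => rw [← Nat.add_assoc, extends_shift_iff, ih, Nat.add_right_comm, Nat.add_assoc]

theorem ProjResolution.extends_of_projective (r : ProjResolution R) {n : ℕ}
    [Module.Projective R (r.M n)] (E : Type*) [AddCommGroup E] [Module R E] :
    LinearMap.Extends (r.i n) E :=
  LinearMap.extends_of_projective (r.inj n) (r.surj n) (r.exact n)

theorem ProjResolution.extends_of_repAt (r : ProjResolution R) {T : ModuleCat.{u} Rᵐᵒᵖ}
    (c : SyzygyChain Rᵐᵒᵖ T) {d k : ℕ} (hk : RepAt Rᵐᵒᵖ c k) (hkd : k ≤ d)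
    (hr : ∀ n, d < n → Module.Projective R (r.M n)) :
    LinearMap.Extends (r.i d) (OpDual (c.Ω 0)) := by
  obtain ⟨ι, A, P, hP, hA, ⟨e⟩⟩ := hk
  obtain ⟨m, rfl⟩ := Nat.exists_eq_add_of_le' hkd
  refine (r.extends_add_iff (.ofSyzygyChain c) m 0 k).2 ?_
  rw [Nat.zero_add]
  refine OpDual.extends_of_retract (Y := P × DirectSum ι fun i ↦ A i) ?_ e.toLinearMap
    e.symm.toLinearMap (LinearMap.ext e.symm_apply_apply)
  refine OpDual.extends_prod (OpDual.extends_of_projective (r.inj m))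
    (OpDual.extends_directSum _ fun i ↦ ?_)
  obtain ⟨j, ⟨C, ⟨f⟩⟩, hj⟩ := (hA i).exists_gt k
  refine OpDual.extends_of_retract (Y := c.Ω j) ?_ (f.toLinearMap ∘ₗ LinearMap.inl _ _ _)
    (LinearMap.fst _ _ _ ∘ₗ f.symm.toLinearMap) (LinearMap.ext fun x ↦ by simp)
  have := (r.extends_add_iff (.ofSyzygyChain c) m 0 j).1
    (have := hr (m + j) (by omega); r.extends_of_projective _)
  rwa [Nat.zero_add] at this

theorem bigFinDim_le_of_repAt [IsArtinianRing R] [IsArtinianRing Rᵐᵒᵖ] {T : ModuleCat.{u} Rᵐᵒᵖ}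
    (c : SyzygyChain Rᵐᵒᵖ T) (hemb : EmbedsIn Rᵐᵒᵖ (radQuot Rᵐᵒᵖ) T) {k : ℕ}
    (hk : RepAt Rᵐᵒᵖ c k) : bigFinDim R ≤ k := by
  refine sSup_le ?_
  rintro _ ⟨htop, M, rfl⟩
  have hne : {d : ℕ∞ | ∃ n : ℕ, d = n ∧ PdimLE R n M}.Nonempty := by
    by_contra! h
    exact htop (by rw [pdim, h, sInf_empty])
  obtain ⟨d, hd, hM⟩ := csInf_mem hne
  rw [pdim, hd]
  by_contra! hlt
  rw [Nat.cast_lt] at hlt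
  obtain ⟨d, rfl⟩ := Nat.exists_eq_add_of_lt hlt
  obtain ⟨r, ⟨e⟩, hr⟩ := hM.exists_resolution
  have h1 := r.extends_of_repAt c hk (Nat.le_add_right k d) fun n hn ↦ hr n hn
  obtain ⟨g, hg⟩ := hemb
  obtain ⟨e0⟩ := c.iso0
  have := r.projective (k + d)
  have := hr (k + d + 1) le_rfl
  have h2 : LinearMap.Extends (r.i (k + d)) (OpDual (Rᵐᵒᵖ ⧸ ringRadical Rᵐᵒᵖ)) := fun φ ↦ by
    have hs : Function.Surjective (OpDual.map (e0.symm.toLinearMap ∘ₗ g)) :=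
      OpDual.map_surjective (e0.symm.injective.comp hg)
    obtain ⟨ψ, hψ⟩ := Module.projective_lifting_property _ φ hs
    obtain ⟨H, hH⟩ := h1 ψ
    exact ⟨OpDual.map (e0.symm.toLinearMap ∘ₗ g) ∘ₗ H, by rw [LinearMap.comp_assoc, hH, hψ]⟩
  have h3 := projective_of_extends_radQuot (r.surj (k + d)) (r.exact (k + d)) h2
  have h4 : sInf {d : ℕ∞ | ∃ n : ℕ, d = n ∧ PdimLE R n M} ≤ (k + d : ℕ) :=
    sInf_le ⟨k + d, rfl, (r.pdimLE h3).congr e⟩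
  rw [hd, Nat.cast_le] at h4
  omega

end Repetition

section KrullSchmidt

/-- `X` is a retract of `Y`. -/
def IsRetract (R : Type*) [Ring R] (X Y : Type*) [AddCommGroup X] [AddCommGroup Y] [Module R X]
    [Module R Y] : Prop :=
  ∃ (u : X →ₗ[R] Y) (v : Y →ₗ[R] X), v ∘ₗ u = LinearMap.id

variable {R : Type*} [Ring R] {X Y Z K L P Q : Type*} [AddCommGroup X] [AddCommGroup Y]
  [AddCommGroup Z] [Module R X] [Module R Y] [Module R Z] [AddCommGroup K] [AddCommGroup L]
  [AddCommGroup P] [AddCommGroup Q] [Module R K] [Module R L] [Module R P] [Module R Q]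

theorem IsRetract.trans (h : IsRetract R X Y) (h' : IsRetract R Y Z) : IsRetract R X Z := by
  obtain ⟨u, v, huv⟩ := h
  obtain ⟨u', v', huv'⟩ := h'
  refine ⟨u' ∘ₗ u, v ∘ₗ v', ?_⟩
  rw [LinearMap.comp_assoc, ← LinearMap.comp_assoc _ _ v', huv', LinearMap.id_comp, huv]

theorem IsRetract.of_equiv (e : X ≃ₗ[R] Y) : IsRetract R X Y :=
  ⟨e.toLinearMap, e.symm.toLinearMap, LinearMap.ext e.symm_apply_apply⟩

theorem IsRetract.inl : IsRetract R X (X × Y) :=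
  ⟨LinearMap.inl R X Y, LinearMap.fst R X Y, LinearMap.fst_comp_inl R X Y⟩

theorem IsRetract.projective (h : IsRetract R X Y) [Module.Projective R Y] :
    Module.Projective R X := by
  obtain ⟨u, v, huv⟩ := h
  exact Module.Projective.of_split u v huv

theorem IsRetract.pi_single {ι : Type*} (Y : ι → Type*) [∀ i, AddCommGroup (Y i)]
    [∀ i, Module R (Y i)] (i : ι) : IsRetract R (Y i) (∀ i, Y i) := by
  classical
  exact ⟨LinearMap.single R Y i, LinearMap.proj i, LinearMap.proj_comp_single_same R Y i⟩

theorem Module.Projective.pi_of_finite {ι : Type*} [Finite ι] (Y : ι → Type*)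
    [∀ i, AddCommGroup (Y i)] [∀ i, Module R (Y i)] [∀ i, Module.Projective R (Y i)] :
    Module.Projective R (∀ i, Y i) := by
  classical
  have := Fintype.ofFinite ι
  exact Module.Projective.of_equiv' (DirectSum.linearEquivFunOnFintype R ι Y)

theorem IsRetract.of_isUnit {u : X →ₗ[R] Y} {v : Y →ₗ[R] X}
    (h : IsUnit (v ∘ₗ u : Module.End R X)) : IsRetract R X Y := by
  obtain ⟨w, hw⟩ := h
  refine ⟨u, (↑w⁻¹ : Module.End R X) ∘ₗ v, ?_⟩
  rw [LinearMap.comp_assoc, ← hw]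
  exact w.inv_mul

theorem IsLocalRing.exists_isUnit_of_isUnit_sum {S : Type*} [Ring S] [IsLocalRing S] {ι : Type*}
    (s : Finset ι) (f : ι → S) (h : IsUnit (∑ i ∈ s, f i)) : ∃ i ∈ s, IsUnit (f i) := by
  classical
  induction s using Finset.induction_on with
  | empty => simp at h
  | insert a s ha ih =>
    rw [Finset.sum_insert ha] at h
    obtain ⟨w, hw⟩ := h
    have h1 : f a * ↑w⁻¹ + (∑ i ∈ s, f i) * ↑w⁻¹ = 1 := by rw [← add_mul, ← hw, w.mul_inv]
    rcases IsLocalRing.isUnit_or_isUnit_of_add_one h1 with h2 | h2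
    · exact ⟨a, Finset.mem_insert_self a s, by simpa using h2⟩
    · obtain ⟨i, hi, h3⟩ := ih (by simpa using h2)
      exact ⟨i, Finset.mem_insert_of_mem hi, h3⟩

theorem IsRetract.exists_of_pi [IsLocalRing (Module.End R X)] {ι : Type*} [Finite ι]
    (Y : ι → Type*) [∀ i, AddCommGroup (Y i)] [∀ i, Module R (Y i)]
    (h : IsRetract R X (∀ i, Y i)) : ∃ i, IsRetract R X (Y i) := by
  classical
  have := Fintype.ofFinite ι
  obtain ⟨u, v, huv⟩ := h
  have hsum : ∑ i, (v ∘ₗ LinearMap.single R Y i) ∘ₗ (LinearMap.proj i ∘ₗ u) =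
      (1 : Module.End R X) := by
    rw [← show v ∘ₗ u = (1 : Module.End R X) from huv]
    ext x
    simp only [LinearMap.sum_apply, LinearMap.comp_apply, LinearMap.proj_apply,
      LinearMap.single_apply, ← map_sum]
    rw [LinearMap.sum_single_apply]
  obtain ⟨i, -, hi⟩ := IsLocalRing.exists_isUnit_of_isUnit_sum Finset.univ
    (fun i ↦ ((v ∘ₗ LinearMap.single R Y i) ∘ₗ (LinearMap.proj i ∘ₗ u) : Module.End R X))
    (hsum ▸ isUnit_one)
  exact ⟨i, .of_isUnit hi⟩

theorem IsRetract.or_of_prod [IsLocalRing (Module.End R X)] (h : IsRetract R X (Y × Z)) :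
    IsRetract R X Y ∨ IsRetract R X Z := by
  obtain ⟨u, v, huv⟩ := h
  have hsum : ((v ∘ₗ LinearMap.inl R Y Z) ∘ₗ (LinearMap.fst R Y Z ∘ₗ u) : Module.End R X) +
      (v ∘ₗ LinearMap.inr R Y Z) ∘ₗ (LinearMap.snd R Y Z ∘ₗ u) = 1 := by
    rw [← show v ∘ₗ u = (1 : Module.End R X) from huv]
    ext x
    simp [← map_add]
  exact (IsLocalRing.isUnit_or_isUnit_of_add_one hsum).imp .of_isUnit .of_isUnit

/-- A relative version of Schanuel's lemma. -/
theorem IsRetract.syzygy [Module.Projective R P] [Module.Projective R Q] {i : K →ₗ[R] P}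
    {p : P →ₗ[R] X} {j : L →ₗ[R] Q} {q : Q →ₗ[R] Y} (hi : Function.Injective i)
    (hp : Function.Surjective p) (hip : Function.Exact i p) (hj : Function.Injective j)
    (hq : Function.Surjective q) (hjq : Function.Exact j q) (h : IsRetract R X Y) :
    IsRetract R K (L × P) := by
  obtain ⟨u, v, huv⟩ := h
  obtain ⟨φ, hφ⟩ := Module.projective_lifting_property q (u ∘ₗ p) hq
  obtain ⟨ψ, hψ⟩ := Module.projective_lifting_property p (v ∘ₗ q) hp
  obtain ⟨a, ha⟩ := LinearMap.exists_comp_eq_of_exact_of_injective hj hjq (φ ∘ₗ i) (by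
    rw [← LinearMap.comp_assoc, hφ, LinearMap.comp_assoc, hip.linearMap_comp_eq_zero,
      LinearMap.comp_zero])
  obtain ⟨b, hb⟩ := LinearMap.exists_comp_eq_of_exact_of_injective hi hip
    (ψ ∘ₗ j ∘ₗ LinearMap.fst R L P + (LinearMap.id - ψ ∘ₗ φ) ∘ₗ LinearMap.snd R L P) (by
    rw [LinearMap.comp_add, ← LinearMap.comp_assoc, hψ, ← LinearMap.comp_assoc _ _ p,
      LinearMap.comp_sub, ← LinearMap.comp_assoc _ _ p, hψ, LinearMap.comp_assoc φ q v, hφ,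
      ← LinearMap.comp_assoc p u v, huv, LinearMap.comp_assoc _ q v,
      ← LinearMap.comp_assoc _ j q, hjq.linearMap_comp_eq_zero]
    simp)
  refine ⟨a.prod i, b, ?_⟩
  rw [← LinearMap.cancel_left hi, ← LinearMap.comp_assoc, hb]
  ext x
  have := LinearMap.congr_fun ha x
  simp only [LinearMap.comp_apply] at this
  simp [this]

theorem Module.Projective.of_exact [Module.Projective R P] [Module.Projective R X] {i : K →ₗ[R] P}
    {p : P →ₗ[R] X} (hi : Function.Injective i) (hp : Function.Surjective p)
    (hip : Function.Exact i p) : Module.Projective R K := by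
  obtain ⟨r, hr⟩ := LinearMap.extends_of_projective (E := K) hi hp hip LinearMap.id
  exact Module.Projective.of_split i r hr

/-- A nonprojective module with local endomorphism ring which is a retract of a syzygy of a finite
direct sum is a retract of a syzygy of one of the summands. -/
theorem IsRetract.exists_of_syzygy_pi [IsLocalRing (Module.End R X)]
    (hX : ¬ Module.Projective R X) {ι : Type*} [Finite ι] {Y K P : ι → Type*}
    [∀ i, AddCommGroup (Y i)] [∀ i, Module R (Y i)] [∀ i, AddCommGroup (K i)]
    [∀ i, Module R (K i)] [∀ i, AddCommGroup (P i)] [∀ i, Module R (P i)]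
    [∀ i, Module.Projective R (P i)] [Module.Projective R Q] {i : ∀ l, K l →ₗ[R] P l}
    {p : ∀ l, P l →ₗ[R] Y l} (hi : ∀ l, Function.Injective (i l))
    (hp : ∀ l, Function.Surjective (p l)) (hip : ∀ l, Function.Exact (i l) (p l))
    {j : L →ₗ[R] Q} {q : Q →ₗ[R] Z} (hj : Function.Injective j) (hq : Function.Surjective q)
    (hjq : Function.Exact j q) (hZ : IsRetract R Z (∀ l, Y l)) (h : IsRetract R X L) :
    ∃ l, IsRetract R X (K l) := by
  have := Module.Projective.pi_of_finite (R := R) P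
  have hinj : Function.Injective (LinearMap.piMap i) := Function.Injective.piMap hi
  have hsurj : Function.Surjective (LinearMap.piMap p) := Function.Surjective.piMap hp
  have hexact : Function.Exact (LinearMap.piMap i) (LinearMap.piMap p) := fun x ↦ by
    constructor
    · intro hx
      choose y hy using fun l ↦ (hip l (x l)).1 (congrFun hx l)
      exact ⟨y, funext hy⟩
    · rintro ⟨y, rfl⟩
      exact funext fun l ↦ (hip l _).2 ⟨y l, rfl⟩
  rcases (h.trans (hZ.syzygy hj hq hjq hinj hsurj hexact)).or_of_prod with h1 | h1
  · exact h1.exists_of_pi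
  · exact absurd h1.projective hX

end KrullSchmidt

theorem isSummand_iff_isRetract {R : Type u} [Ring R] {A B : ModuleCat.{u} R} :
    IsSummand R A B ↔ IsRetract R A B := by
  constructor
  · rintro ⟨C, ⟨e⟩⟩
    exact IsRetract.inl.trans (.of_equiv e)
  · rintro ⟨u, v, huv⟩
    refine ⟨.of R (LinearMap.ker v), ⟨?_⟩⟩
    have hv (x : A) : v (u x) = x := LinearMap.congr_fun huv x
    exact
      { toFun := fun x ↦ u x.1 + x.2.1
        map_add' := fun x y ↦ by simp; abel
        map_smul' := fun r x ↦ by simp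
        invFun := fun b ↦ (v b, ⟨b - u (v b), by simp [hv]⟩)
        left_inv := fun ⟨x, y, hy⟩ ↦ by
          have hy' : v y = 0 := hy
          simp [hv, hy']
        right_inv := fun b ↦ by simp }

/-- A finite set with a strict increase of `c` along each of `n` backward steps
has more than `n` elements. -/
theorem lt_card_of_backward_steps {ι : Type*} [Fintype ι] (occ : ℕ → ι → Prop) (c : ι → ℕ)
    (hstep : ∀ j i, occ (j + 1) i → ∃ i', occ j i' ∧ c i' < c i) {n : ℕ} {i : ι}
    (hi : occ n i) : n < Fintype.card ι := by
  classical
  have key (n : ℕ) (i : ι) (hi : occ n i) : n < (Finset.univ.filter fun k ↦ c k ≤ c i).card := by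
    induction n generalizing i with
    | zero => exact Finset.card_pos.2 ⟨i, by simp⟩
    | succ n ih =>
      obtain ⟨i', hi', hlt⟩ := hstep n i hi
      refine (Nat.succ_le_of_lt (ih i' hi')).trans_lt (Finset.card_lt_card ?_)
      rw [Finset.ssubset_iff_of_subset]
      · exact ⟨i, by simp, by simpa using hlt⟩
      · intro k hk
        simp only [Finset.mem_filter, Finset.mem_univ, true_and] at hk ⊢
        omega
  exact (key n i hi).trans_le (Finset.card_le_univ _)

section SyzygyType

variable {R : Type u} [Ring R] {T : ModuleCat.{u} R} {c : SyzygyChain R T} {s : ℕ}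
  {A : Fin s → ModuleCat.{u} R}

theorem HasSyzygyType.infinite_of_isRetract (h : HasSyzygyType R c s A) {i : Fin s}
    (hi : IsRetract R (A i) (c.Ω s)) (hproj : ¬ Module.Projective R (A i)) :
    {j : ℕ | IsRetract R (A i) (c.Ω j)}.Infinite := by
  obtain ⟨hloc, -, -, hdec⟩ := h
  let t := ProjResolution.ofSyzygyChain c
  have ht := t.projective
  let p (i : Fin s) : (A i →₀ R) →ₗ[R] A i := Finsupp.linearCombination R id
  have hp (i : Fin s) : Function.Surjective (p i) := Finsupp.linearCombination_id_surjective R _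
  let K (i : Fin s) := LinearMap.ker (p i)
  have up {i k : Fin s} {j : ℕ} (hk : ¬ Module.Projective R (A k))
      (hik : IsRetract R (A k) (K i)) (hij : IsRetract R (A i) (c.Ω j)) :
      IsRetract R (A k) (c.Ω (j + 1)) := by
    have := hloc k
    rcases (hik.trans (hij.syzygy (Subtype.val_injective (p := (· ∈ K i))) (hp i)
      (LinearMap.exact_subtype_ker_map (p i)) (t.inj j) (t.surj j) (t.exact j))).or_of_prod
      with h1 | h1
    · exact h1
    · exact absurd h1.projective hk
  have down {k : Fin s} {j : ℕ} (hk : ¬ Module.Projective R (A k))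
      (hj : IsRetract R (A k) (c.Ω (j + 1))) :
      ∃ i, IsRetract R (A i) (c.Ω j) ∧ IsRetract R (A k) (K i) := by
    have := hloc k
    obtain ⟨m, ⟨e⟩⟩ := hdec j
    obtain ⟨⟨i, l⟩, h2⟩ := IsRetract.exists_of_syzygy_pi hk (ι := Σ i, Fin (m i))
      (Y := fun x ↦ A x.1) (K := fun x ↦ K x.1) (i := fun x ↦ (K x.1).subtype)
      (p := fun x ↦ p x.1)
      (fun x ↦ Subtype.val_injective (p := (· ∈ K x.1))) (fun x ↦ hp x.1)
      (fun x ↦ LinearMap.exact_subtype_ker_map (p x.1)) (t.inj j) (t.surj j) (t.exact j)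
      (.of_equiv (e.trans (LinearEquiv.piCurry R fun i (_ : Fin (m i)) ↦ A i).symm)) hj
    exact ⟨i, ((IsRetract.pi_single (fun _ : Fin (m i) ↦ A i) l).trans
      (IsRetract.pi_single (fun i ↦ Fin (m i) → A i) i)).trans (.of_equiv e.symm), h2⟩
  by_contra hfin
  rw [Set.not_infinite] at hfin
  let occ (i : Fin s) : Set ℕ := {j | IsRetract R (A i) (c.Ω j)}
  have hcard := lt_card_of_backward_steps (n := s) (i := i)
    (fun j i ↦ ¬ Module.Projective R (A i) ∧ (occ i).Finite ∧ j ∈ occ i)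
    (fun i ↦ sSup (occ i)) (by
      rintro j k ⟨hk, hkfin, hkj⟩
      obtain ⟨i, hij, hik⟩ := down hk hkj
      have hmap : Set.MapsTo (· + 1) (occ i) (occ k) := fun l hl ↦ up hk hik hl
      have hifin : (occ i).Finite :=
        Set.Finite.of_finite_image (hkfin.subset hmap.image_subset)
          (add_left_injective 1).injOn
      refine ⟨i, ⟨fun hi ↦ hk ?_, hifin, hij⟩, ?_⟩
      · have := Module.Projective.of_exact (K := K i) (P := A i →₀ R) (X := A i)
          (i := (K i).subtype) (p := p i) (K i).injective_subtype (hp i)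
          (LinearMap.exact_subtype_ker_map (p i))
        exact hik.projective
      · have := hmap (Nat.sSup_mem ⟨j, hij⟩ hifin.bddAbove)
        exact Nat.lt_of_succ_le (le_csSup hkfin.bddAbove this))
    ⟨hproj, hfin, hi⟩
  simp at hcard

theorem HasSyzygyType.repAt (h : HasSyzygyType R c s A) : RepAt R c s := by
  classical
  obtain ⟨m, ⟨e⟩⟩ := h.2.2.2 s
  let p (i : Fin s) : Prop := Module.Projective R (A i)
  let B (i : Fin s) := Fin (m i) → A i
  let e1 : ((i : Fin s) → B i) ≃ₗ[R]
      ((i : {i // p i}) → B i) × ((i : {i // ¬ p i}) → B i) :=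
    { Equiv.piEquivPiSubtypeProd p (fun i ↦ B i) with
      map_add' := fun _ _ ↦ rfl
      map_smul' := fun _ _ ↦ rfl }
  let ι := ULift.{u} (Σ i : {i // ¬ p i}, Fin (m i))
  let e2 : ((i : {i // ¬ p i}) → B i) ≃ₗ[R] ((x : ι) → A x.down.1) :=
    { toFun := fun f x ↦ f x.down.1 x.down.2
      invFun := fun f i k ↦ f ⟨i, k⟩
      map_add' := fun _ _ ↦ rfl
      map_smul' := fun _ _ ↦ rfl
      left_inv := fun _ ↦ rfl
      right_inv := fun _ ↦ rfl }
  have hr (i : Fin s) (k : Fin (m i)) : IsRetract R (A i) (c.Ω s) :=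
    ((IsRetract.pi_single (fun _ : Fin (m i) ↦ A i) k).trans
      (IsRetract.pi_single (fun i ↦ Fin (m i) → A i) i)).trans (.of_equiv e.symm)
  have hP (i : {i // p i}) : Module.Projective R (A i) := i.2
  refine ⟨ι, fun x ↦ A x.down.1, .of R ((i : {i // p i}) → B i), ?_, fun x ↦ ?_, ⟨?_⟩⟩
  · have (i : {i // p i}) : Module.Projective R (B i) := Module.Projective.pi_of_finite _
    exact Module.Projective.pi_of_finite _
  · simp_rw [isSummand_iff_isRetract]
    exact h.infinite_of_isRetract (hr x.down.1 x.down.2) x.down.1.2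
  · exact e.trans (e1.trans ((LinearEquiv.refl R _).prodCongr
      (e2.trans (DirectSum.linearEquivFunOnFintype R ι fun x ↦ A x.down.1).symm)))

end SyzygyType

/-- Let `Λ` be an artinian ring with Jacobson radical `J`, and let
`T` be a right `Λ`-module of finite syzygy type `s` in which `Λ/J` embeds.  Then
`l Fin dim Λ ≤ rep T ≤ s`. -/
theorem bigFinDim_le_repIndex_le_syzygyType (Λ : Type u) [Ring Λ]
    [IsArtinianRing Λ] [IsArtinianRing Λᵐᵒᵖ]
    (T : ModuleCat.{u} Λᵐᵒᵖ) (cT : SyzygyChain Λᵐᵒᵖ T)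
    (s : ℕ) (A : Fin s → ModuleCat.{u} Λᵐᵒᵖ) (hst : HasSyzygyType Λᵐᵒᵖ cT s A)
    (hemb : EmbedsIn Λᵐᵒᵖ (radQuot Λᵐᵒᵖ) T) :
    bigFinDim Λ ≤ repIndex Λᵐᵒᵖ cT ∧ repIndex Λᵐᵒᵖ cT ≤ (s : ℕ∞) := by
  refine ⟨le_sInf ?_, sInf_le ⟨s, rfl, hst.repAt⟩⟩
  rintro _ ⟨k, rfl, hk⟩
  exact bigFinDim_le_of_repAt cT hemb hk
end

section
/- Let Λ be an artinian ring with Jacobson radical J, let T be a right Λ-module of finite syzygy type s such that Λ/J embeds into T as a right Λ-module, and let A_1, …, A_s be representatives of the isomorphism types of the nonzero indecomposable objects in the syzygy category of T. Then l Fin dim Λ ≤ 1 + max{σ_T(A_i) : 1 ≤ i ≤ s, A_i non-projective and σ_T(A_i) < ∞}. -/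
open CategoryTheory

universe u

theorem unop_mem_jacobson_of_mem_jacobson {R S : Type*} [Ring R] [Ring S] [IsSemiprimaryRing R]
    (e : R ≃+* Sᵐᵒᵖ) {r : R} (hr : r ∈ Ring.jacobson R) :
    (e r).unop ∈ Ring.jacobson S := by
  rw [← Ideal.jacobson_bot, Ideal.mem_jacobson_iff]
  intro y
  obtain ⟨n, hn⟩ := IsSemiprimaryRing.isNilpotent (R := R)
  have hmem : r * e.symm (.op y) ∈ Ring.jacobson R := Ideal.mul_mem_right _ _ hr
  have hnil : IsNilpotent (r * e.symm (.op y)) := by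
    refine ⟨n, ?_⟩
    have := Submodule.pow_mem_pow _ hmem n
    rwa [hn] at this
  have hnil' : IsNilpotent (y * (e r).unop) := by
    have := hnil.map e
    rw [map_mul, RingEquiv.apply_symm_apply] at this
    obtain ⟨k, hk⟩ := this
    exact ⟨k, by simpa using congrArg MulOpposite.unop hk⟩
  obtain ⟨u, hu⟩ := hnil'.isUnit_add_one
  refine ⟨↑u⁻¹, ?_⟩
  have : (↑u⁻¹ : S) * (y * (e r).unop + 1) = 1 := by rw [← hu]; simp
  rw [mul_add, mul_one, ← mul_assoc] at this
  simp [this]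

namespace Submodule

variable {R : Type*} [Ring R] {M : Type*} [AddCommGroup M] [Module R M]

theorem isNilpotent_end_of_range_le {I : Ideal R} [I.IsTwoSided] (hI : IsNilpotent I)
    {g : Module.End R M} (hg : LinearMap.range g ≤ I • (⊤ : Submodule R M)) : IsNilpotent g := by
  obtain ⟨n, hn⟩ := hI
  have key : ∀ k, LinearMap.range (g ^ k) ≤ I ^ k • (⊤ : Submodule R M) := by
    intro k
    induction k with
    | zero => rw [I.pow_zero, Ideal.one_eq_top, top_smul]; exact le_top
    | succ k ih =>
      rw [pow_succ', Module.End.mul_eq_comp, LinearMap.range_comp]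
      refine (Submodule.map_mono ih).trans ?_
      rw [Submodule.map_smul'', Submodule.map_top, I.pow_succ, Submodule.mul_smul]
      exact smul_mono le_rfl hg
  refine ⟨n, LinearMap.range_eq_bot.mp (le_bot_iff.mp ((key n).trans ?_))⟩
  simp [hn]

theorem eq_top_of_sup_smul_eq_top {I : Ideal R} [I.IsTwoSided] (hI : IsNilpotent I)
    {N : Submodule R M} (h : N ⊔ I • ⊤ = ⊤) : N = ⊤ := by
  obtain ⟨n, hn⟩ := hI
  have key : ∀ k, N ⊔ I ^ k • (⊤ : Submodule R M) = ⊤ := by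
    intro k
    induction k with
    | zero => rw [I.pow_zero, Ideal.one_eq_top, top_smul, sup_top_eq]
    | succ k ih =>
      rw [eq_top_iff]
      refine ih.ge.trans (sup_le le_sup_left ?_)
      conv_lhs => rw [← h]
      rw [smul_sup, I.pow_succ, Submodule.mul_smul]
      exact sup_le_sup_right smul_le_right _
  simpa [hn] using key n

end Submodule

theorem isSemisimpleModule_quotient_jacobson_smul {R : Type*} [Ring R] [IsSemiprimaryRing R]
    (M : Type*) [AddCommGroup M] [Module R M] :
    IsSemisimpleModule R (M ⧸ (Ring.jacobson R • (⊤ : Submodule R M))) := by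
  have h : Module.IsTorsionBySet R (M ⧸ (Ring.jacobson R • (⊤ : Submodule R M)))
      (Ring.jacobson R) := (Module.isTorsionBySet_quotient_iff _ _).2
    fun m r hr ↦ Submodule.smul_mem_smul hr trivial
  let _ := h.module
  exact (h.semilinearMap.isSemisimpleModule_iff_of_bijective Function.bijective_id).2
    inferInstance

theorem exists_projective_ker_le_jacobson_smul {R : Type u} [Ring R] [IsSemiprimaryRing R]
    (M : ModuleCat.{u} R) :
    ∃ (P : ModuleCat.{u} R) (f : P →ₗ[R] M), Module.Projective R P ∧ Function.Surjective f ∧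
      LinearMap.ker f ≤ Ring.jacobson R • ⊤ := by
  let F := M →₀ R
  let π : F →ₗ[R] M := Finsupp.linearCombination R id
  have hπ : Function.Surjective π := Finsupp.linearCombination_id_surjective R M
  have hJ := IsSemiprimaryRing.isNilpotent (R := R)
  let N : Submodule R F := Ring.jacobson R • ⊤
  have hN (g : Module.End R F) : N ≤ N.comap g := by
    rw [← Submodule.map_le_iff_le_comap, Submodule.map_smul'']
    exact Submodule.smul_mono le_rfl le_top
  let Φ : Module.End R F →+* Module.End R (F ⧸ N) :=
    { toFun g := N.mapQ N g (hN g)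
      map_one' := Submodule.mapQ_id ..
      map_mul' g h := Submodule.mapQ_comp ..
      map_zero' := by ext; simp
      map_add' g h := by ext; simp }
  have _ := isSemisimpleModule_quotient_jacobson_smul (R := R) F
  obtain ⟨C, hC⟩ := exists_isCompl ((LinearMap.ker π).map N.mkQ)
  obtain ⟨g, hg⟩ := Module.projective_lifting_property N.mkQ
    (((LinearMap.ker π).map N.mkQ).projection C hC ∘ₗ N.mkQ) N.mkQ_surjective
  have hΦg : Φ g = ((LinearMap.ker π).map N.mkQ).projection C hC :=
    LinearMap.cancel_right N.mkQ_surjective |>.1 hg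
  obtain ⟨e, he, heg⟩ := exists_isIdempotentElem_eq_of_ker_isNilpotent Φ (fun x hx ↦ by
      refine Submodule.isNilpotent_end_of_range_le hJ ?_
      rintro _ ⟨y, rfl⟩
      have := LinearMap.congr_fun (RingHom.mem_ker.1 hx) (N.mkQ y)
      exact (Submodule.Quotient.mk_eq_zero N).1 this) _ ⟨g, hΦg⟩
      (Submodule.isIdempotentElem_projection hC)
  have hmk (x : F) : N.mkQ (e x) = ((LinearMap.ker π).map N.mkQ).projection C hC (N.mkQ x) :=
    LinearMap.congr_fun heg (N.mkQ x)
  have hee (x : F) : e (e x) = e x := LinearMap.congr_fun he x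
  let P := LinearMap.range (1 - e)
  let p : F →ₗ[R] P := (1 - e).rangeRestrict
  have hp (x : P) : p x = x := by
    obtain ⟨_, y, rfl⟩ := x
    ext1
    simp [p, hee]
  have hproj : Module.Projective R P :=
    Module.Projective.of_split P.subtype p (LinearMap.ext hp)
  refine ⟨ModuleCat.of R P, π ∘ₗ P.subtype, hproj, ?_, ?_⟩
  · rw [← LinearMap.range_eq_top]
    refine Submodule.eq_top_of_sup_smul_eq_top hJ (eq_top_iff.2 ?_)
    rintro m -
    obtain ⟨x, rfl⟩ := hπ m
    obtain ⟨k, hk, hkx⟩ := Submodule.mem_map.1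
      (hmk x ▸ Submodule.projection_apply_mem hC (N.mkQ x) :
        N.mkQ (e x) ∈ (LinearMap.ker π).map N.mkQ)
    have hsub : e x - k ∈ N := (Submodule.Quotient.eq N).1 hkx.symm
    have hx : π x = π ((1 - e) x) + π (e x - k) := by
      simp [LinearMap.mem_ker.1 hk]
    rw [hx]
    refine Submodule.add_mem_sup ⟨p x, rfl⟩ ?_
    have := Submodule.mem_map_of_mem (f := π) hsub
    rw [Submodule.map_smul''] at this
    exact Submodule.smul_mono le_rfl le_top this
  · intro x hx
    have hx' : (x : F) ∈ LinearMap.ker π := hx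
    have h1 : N.mkQ (e x) = N.mkQ x := by
      rw [hmk]
      exact Submodule.projection_apply_left hC ⟨_, Submodule.mem_map_of_mem hx'⟩
    have h2 : (x : F) - e x ∈ N := (Submodule.Quotient.eq N).1 h1.symm
    have h3 := Submodule.mem_map_of_mem (f := p) h2
    rw [Submodule.map_smul''] at h3
    have h4 : p (x - e x) = x := by
      rw [map_sub, hp, sub_eq_self]
      ext1
      simp [p, hee]
    rw [h4] at h3
    exact Submodule.smul_mono le_rfl le_top h3

namespace CharacterModule

variable {R : Type*} [Ring R] {M N : Type*} [AddCommGroup M] [AddCommGroup N]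
  [Module R M] [Module R N]

/-- The character module of a left module is a right module. -/
instance moduleMulOpposite : Module Rᵐᵒᵖ (CharacterModule M) where
  smul r φ := (φ : M →+ AddCircle (1 : ℚ)).comp (DistribSMul.toAddMonoidHom M r.unop)
  one_smul φ := DFunLike.ext _ _ fun x ↦ congrArg φ (one_smul R x)
  mul_smul r s φ := DFunLike.ext _ _ fun x ↦ congrArg φ (mul_smul s.unop r.unop x)
  smul_zero _ := rfl
  smul_add _ _ _ := rfl
  add_smul r s φ := DFunLike.ext _ _ fun x ↦
    (congrArg φ (add_smul r.unop s.unop x)).trans (map_add φ _ _)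
  zero_smul φ := DFunLike.ext _ _ fun x ↦ (congrArg φ (zero_smul R x)).trans (map_zero φ)

/-- The transpose of a linear map, as a map of right modules. -/
def transpose (f : M →ₗ[R] N) : CharacterModule N →ₗ[Rᵐᵒᵖ] CharacterModule M where
  toFun φ := AddMonoidHom.comp φ f.toAddMonoidHom
  map_add' _ _ := rfl
  map_smul' r φ := DFunLike.ext _ _ fun x ↦ congrArg φ (f.map_smul r.unop x).symm

theorem exists_extend {A B : Type*} [AddCommGroup A] [AddCommGroup B] {f : A →+ B}
    (hf : Function.Injective f) (φ : CharacterModule A) :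
    ∃ ψ : CharacterModule B, ∀ x, ψ (f x) = φ x := by
  obtain ⟨ψ, hψ⟩ := dual_surjective_of_injective f.toIntLinearMap hf φ
  exact ⟨ψ, fun x ↦ DFunLike.congr_fun hψ x⟩

theorem exists_ne_zero_of_notMem {A : Type*} [AddCommGroup A] (B : AddSubgroup A) {a : A}
    (ha : a ∉ B) : ∃ φ : CharacterModule A, (∀ b ∈ B, φ b = 0) ∧ φ a ≠ 0 := by
  obtain ⟨φ, hφ⟩ := exists_character_apply_ne_zero_of_ne_zero
    (a := (QuotientAddGroup.mk' B a)) (by simpa using ha)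
  refine ⟨AddMonoidHom.comp φ (QuotientAddGroup.mk' B), fun b hb ↦ ?_, hφ⟩
  change φ (QuotientAddGroup.mk' B b) = 0
  rw [show QuotientAddGroup.mk' B b = 0 from (QuotientAddGroup.eq_zero_iff b).2 hb, map_zero]

variable (R M) in
/-- The character module of a projective left module is an injective right module. -/
theorem injective_of_projective [Module.Projective R M] :
    Module.Injective Rᵐᵒᵖ (CharacterModule M) where
  out X Y _ _ _ _ f hf g := by
    obtain ⟨s, hs⟩ := Module.projective_def'.1 ‹Module.Projective R M›
    let v (i : M) : X →+ AddCircle (1 : ℚ) :=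
      { toFun x := g x i
        map_zero' := by rw [map_zero]; rfl
        map_add' x y := by rw [map_add]; rfl }
    choose w hw using fun i ↦ exists_extend (f := f.toAddMonoidHom) hf (v i)
    let k (y : Y) : (M →₀ R) →+ AddCircle (1 : ℚ) := Finsupp.liftAddHom fun i ↦
      { toFun r := w i (MulOpposite.op r • y)
        map_zero' := by simp
        map_add' r r' := by simp [add_smul] }
    have hk (y : Y) (i : M) (r : R) : k y (Finsupp.single i r) = w i (MulOpposite.op r • y) :=
      Finsupp.liftAddHom_apply_single ..
    let h : Y →ₗ[Rᵐᵒᵖ] CharacterModule (M →₀ R) :=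
      { toFun := k
        map_add' y y' := Finsupp.addHom_ext fun i r ↦ by
          change k (y + y') _ = k y _ + k y' _
          rw [hk, hk, hk, smul_add, map_add]
        map_smul' r y := Finsupp.addHom_ext fun i a ↦ by
          change _ = k y (r.unop • Finsupp.single i a)
          rw [Finsupp.smul_single, hk, hk, smul_smul]
          rfl }
    refine ⟨transpose s ∘ₗ h, fun x ↦ DFunLike.ext _ _ fun m ↦ ?_⟩
    have key (z : M →₀ R) : h (f x) z = g x (Finsupp.linearCombination R id z) := by
      induction z using Finsupp.induction_linear with
      | zero => simp
      | add z z' hz hz' => simp only [map_add, hz, hz']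
      | single i a =>
        change k (f x) (Finsupp.single i a) = _
        rw [hk, Finsupp.linearCombination_single]
        change w i (MulOpposite.op a • f x) = (MulOpposite.op a • g x) i
        rw [← map_smul, ← map_smul]
        exact hw i _
    exact (key (s m)).trans (congrArg (g x) (LinearMap.congr_fun hs m))

end CharacterModule

namespace CategoryTheory.ShortComplex.ShortExact

open CategoryTheory.Abelian

variable {C : Type*} [Category C] [Abelian C] [HasExt C] {S : ShortComplex C}

theorem subsingleton_ext_succ_iff_of_injective (hS : S.ShortExact) [Injective S.X₂] (X : C)
    (n : ℕ) : Subsingleton (Ext X S.X₁ (n + 2)) ↔ Subsingleton (Ext X S.X₃ (n + 1)) := by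
  refine ⟨fun _ ↦ ⟨fun a b ↦ ?_⟩, fun _ ↦ ⟨fun a b ↦ ?_⟩⟩
  · have key (x : Ext X S.X₃ (n + 1)) : x = 0 := by
      obtain ⟨y, rfl⟩ := Ext.covariant_sequence_exact₃ X hS x rfl (Subsingleton.elim _ _)
      rw [Ext.eq_zero_of_injective y, Ext.zero_comp]
    rw [key a, key b]
  · have key (x : Ext X S.X₁ (n + 2)) : x = 0 := by
      obtain ⟨y, rfl⟩ := Ext.covariant_sequence_exact₁ X hS x (Ext.eq_zero_of_injective _)
        (rfl : n + 1 + 1 = n + 2)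
      rw [Subsingleton.elim y 0, Ext.zero_comp]
    rw [key a, key b]

theorem subsingleton_ext_succ_iff_of_projective (hS : S.ShortExact) [Projective S.X₂] (Y : C)
    (n : ℕ) : Subsingleton (Ext S.X₃ Y (n + 2)) ↔ Subsingleton (Ext S.X₁ Y (n + 1)) := by
  refine ⟨fun _ ↦ ⟨fun a b ↦ ?_⟩, fun _ ↦ ⟨fun a b ↦ ?_⟩⟩
  · have key (x : Ext S.X₁ Y (n + 1)) : x = 0 := by
      obtain ⟨y, rfl⟩ := Ext.contravariant_sequence_exact₁ hS Y x (add_comm 1 (n + 1))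
        (Subsingleton.elim (α := Ext S.X₃ Y (n + 2)) _ _)
      rw [Ext.eq_zero_of_projective y, Ext.comp_zero]
    rw [key a, key b]
  · have key (x : Ext S.X₃ Y (n + 2)) : x = 0 := by
      obtain ⟨y, rfl⟩ := Ext.contravariant_sequence_exact₃ hS Y x (Ext.eq_zero_of_projective _)
        (add_comm 1 (n + 1))
      rw [Subsingleton.elim y 0, Ext.comp_zero]
    rw [key a, key b]

end CategoryTheory.ShortComplex.ShortExact

namespace CategoryTheory.Abelian.Ext

variable {C : Type*} [Category C] [Abelian C] [HasExt C]

theorem subsingleton_of_retract {X X' Y : C} (r : Retract X X') {n : ℕ}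
    [Subsingleton (Ext X' Y n)] : Subsingleton (Ext X Y n) := by
  refine subsingleton_of_forall_eq 0 fun x ↦ ?_
  have : x = (mk₀ r.i).comp ((mk₀ r.r).comp x (zero_add n)) (zero_add n) := by
    rw [mk₀_comp_mk₀_assoc, r.retract, mk₀_id_comp]
  rw [this, Subsingleton.elim ((mk₀ r.r).comp x (zero_add n)) 0, comp_zero]

theorem subsingleton_of_sum_comp_eq_id {X Y : C} {ι : Type*} [Fintype ι] (Z : ι → C)
    (p : ∀ i, X ⟶ Z i) (q : ∀ i, Z i ⟶ X) (h : ∑ i, p i ≫ q i = 𝟙 X) {n : ℕ}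
    (hZ : ∀ i, Subsingleton (Ext (Z i) Y n)) : Subsingleton (Ext X Y n) := by
  refine subsingleton_of_forall_eq 0 fun x ↦ ?_
  rw [← mk₀_id_comp x, ← h, mk₀_sum, sum_comp]
  refine Finset.sum_eq_zero fun i _ ↦ ?_
  rw [← mk₀_comp_mk₀_assoc, Subsingleton.elim ((mk₀ (q i)).comp x (zero_add n)) 0, comp_zero]

end CategoryTheory.Abelian.Ext

section

open CategoryTheory.Abelian

variable {R : Type u} [Ring R]

/-- The character module of a left module, as an object of the category of right modules. -/
abbrev charDual (M : ModuleCat.{u} R) : ModuleCat.{u} Rᵐᵒᵖ :=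
  ModuleCat.of Rᵐᵒᵖ (CharacterModule M)

/-- The sequence of character modules dual to `0 → ker f → P → M → 0`. -/
abbrev charDualComplex {P M : ModuleCat.{u} R} (f : P →ₗ[R] M) :
    ShortComplex (ModuleCat.{u} Rᵐᵒᵖ) :=
  ModuleCat.shortComplexOfCompEqZero (CharacterModule.transpose f)
    (CharacterModule.transpose (LinearMap.ker f).subtype)
    (LinearMap.ext fun φ ↦ DFunLike.ext _ _ fun x ↦ (congrArg φ x.2).trans (map_zero φ))

theorem charDualComplex_shortExact {P M : ModuleCat.{u} R} {f : P →ₗ[R] M}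
    (hf : Function.Surjective f) : (charDualComplex f).ShortExact := by
  refine ModuleCat.shortComplex_shortExact _ (fun φ ↦ ⟨fun h ↦ ?_, ?_⟩) ?_ ?_
  · obtain ⟨g, hg⟩ := hf.hasRightInverse
    have hφ : f.toAddMonoidHom.ker ≤ AddMonoidHom.ker (φ : P →+ AddCircle (1 : ℚ)) := fun x hx ↦
      DFunLike.congr_fun h (⟨x, hx⟩ : LinearMap.ker f)
    exact ⟨AddMonoidHom.liftOfRightInverse f.toAddMonoidHom g hg ⟨φ, hφ⟩,
      AddMonoidHom.liftOfRightInverse_comp f.toAddMonoidHom g hg ⟨φ, hφ⟩⟩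
  · rintro ⟨φ, rfl⟩
    exact DFunLike.ext _ _ fun x ↦ (congrArg φ x.2).trans (map_zero φ)
  · intro φ ψ h
    refine DFunLike.ext _ _ fun x ↦ ?_
    obtain ⟨x, rfl⟩ := hf x
    exact DFunLike.congr_fun h x
  · intro φ
    obtain ⟨ψ, hψ⟩ := CharacterModule.exists_extend
      (f := (LinearMap.ker f).subtype.toAddMonoidHom) Subtype.val_injective φ
    exact ⟨ψ, DFunLike.ext _ _ hψ⟩

theorem injective_charDual (P : ModuleCat.{u} R) [Module.Projective R P] :
    Injective (charDual P) :=
  have := CharacterModule.injective_of_projective R P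
  Module.injective_object_of_injective_module ..

theorem PdimLE.subsingleton_ext_charDual {n : ℕ} {M : ModuleCat.{u} R} (h : PdimLE R n M)
    (X : ModuleCat.{u} Rᵐᵒᵖ) (k : ℕ) : Subsingleton (Ext X (charDual M) (n + k + 1)) := by
  induction n generalizing M with
  | zero =>
    have : Module.Projective R M := h
    have := injective_charDual M
    exact Ext.subsingleton_of_injective ..
  | succ n ih =>
    obtain ⟨P, f, _, hf, hK⟩ := h
    have := injective_charDual P
    have := ((charDualComplex_shortExact hf).subsingleton_ext_succ_iff_of_injective X (n + k)).2
      (ih hK)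
    rwa [show n + 1 + k + 1 = n + k + 2 by ring]

theorem projective_of_subsingleton_ext_charDual [IsSemiprimaryRing R] [IsSemiprimaryRing Rᵐᵒᵖ]
    {M : ModuleCat.{u} R} (h : Subsingleton (Ext (radQuot Rᵐᵒᵖ) (charDual M) 1)) :
    Module.Projective R M := by
  obtain ⟨P, f, _, hf, hker⟩ := exists_projective_ker_le_jacobson_smul M
  have hbot : LinearMap.ker f = ⊥ := by
    by_contra hne
    have hJK : Ring.jacobson R • (⊤ : Submodule R (LinearMap.ker f)) ≠ ⊤ := by
      intro htop
      have := Submodule.eq_top_of_sup_smul_eq_top (IsSemiprimaryRing.isNilpotent (R := R))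
        (N := (⊥ : Submodule R (LinearMap.ker f))) (by rw [htop, sup_top_eq])
      exact hne (Submodule.subsingleton_iff_eq_bot.1
        ((Submodule.subsingleton_iff R).1 (subsingleton_of_bot_eq_top this)))
    obtain ⟨a, -, ha⟩ := SetLike.exists_of_lt (lt_top_iff_ne_top.2 hJK)
    obtain ⟨φ, hφ, hφa⟩ := CharacterModule.exists_ne_zero_of_notMem
      (Ring.jacobson R • (⊤ : Submodule R (LinearMap.ker f))).toAddSubgroup ha
    let g : (Rᵐᵒᵖ ⧸ ringRadical Rᵐᵒᵖ) →ₗ[Rᵐᵒᵖ] CharacterModule (LinearMap.ker f) :=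
      (ringRadical Rᵐᵒᵖ).liftQ (LinearMap.toSpanSingleton Rᵐᵒᵖ _ φ) fun r hr ↦ by
        have hr' := unop_mem_jacobson_of_mem_jacobson (RingEquiv.refl Rᵐᵒᵖ) hr
        exact DFunLike.ext _ _ fun x ↦ hφ _ (Submodule.smul_mem_smul hr' trivial)
    obtain ⟨y, hy⟩ := Ext.covariant_sequence_exact₃ (radQuot Rᵐᵒᵖ)
      (charDualComplex_shortExact hf) (Ext.mk₀ (ModuleCat.ofHom g)) (zero_add 1)
      (Subsingleton.elim (α := Ext (radQuot Rᵐᵒᵖ) (charDual M) 1) _ _)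
    obtain ⟨y, rfl⟩ := (Ext.mk₀_bijective _ _).2 y
    rw [Ext.mk₀_comp_mk₀] at hy
    have hy' := (Ext.mk₀_bijective _ _).1 hy
    let ψ : CharacterModule P := y.hom (Submodule.Quotient.mk 1)
    have hψφ (x : LinearMap.ker f) : ψ x = φ x := by
      have := ConcreteCategory.congr_hom hy' (Submodule.Quotient.mk 1)
      have h1 : g (Submodule.Quotient.mk 1) = φ :=
        (Submodule.liftQ_apply ..).trans (one_smul Rᵐᵒᵖ φ)
      exact (DFunLike.congr_fun this x).trans (DFunLike.congr_fun h1 x)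
    have hψ : (Ring.jacobson R • (⊤ : Submodule R P)).toAddSubgroup ≤
        AddMonoidHom.ker (ψ : P →+ AddCircle (1 : ℚ)) := by
      intro x hx
      induction (hx : x ∈ Ring.jacobson R • (⊤ : Submodule R P)) using
        Submodule.smul_induction_on' with
      | smul r hr x _ =>
        have hr' : MulOpposite.op r ∈ ringRadical Rᵐᵒᵖ :=
          unop_mem_jacobson_of_mem_jacobson (RingEquiv.opOp R) hr
        have h0 : MulOpposite.op r • ψ = 0 := by
          simp only [ψ]
          rw [← map_smul, ← Submodule.Quotient.mk_smul, smul_eq_mul, mul_one,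
            (Submodule.Quotient.mk_eq_zero _).2 hr', map_zero]
        exact DFunLike.congr_fun h0 x
      | add x _ y _ hx hy => exact add_mem hx hy
    exact hφa ((hψφ a).symm.trans (hψ (hker a.2)))
  exact Module.Projective.of_equiv (LinearEquiv.ofBijective f ⟨LinearMap.ker_eq_bot.1 hbot, hf⟩)

theorem PdimLE.of_subsingleton_ext_charDual [IsSemiprimaryRing R] [IsSemiprimaryRing Rᵐᵒᵖ]
    {n : ℕ} {M : ModuleCat.{u} R} (h : PdimLE R (n + 1) M)
    (hE : Subsingleton (Ext (radQuot Rᵐᵒᵖ) (charDual M) (n + 1))) : PdimLE R n M := by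
  induction n generalizing M with
  | zero => exact projective_of_subsingleton_ext_charDual hE
  | succ n ih =>
    obtain ⟨P, f, hP, hf, hK⟩ := h
    have := injective_charDual P
    exact ⟨P, f, hP, hf, ih hK
      (((charDualComplex_shortExact hf).subsingleton_ext_succ_iff_of_injective _ n).1 hE)⟩

theorem LinearEquiv.subsingleton_ext_iff {A B : ModuleCat.{u} R} (e : A ≃ₗ[R] B)
    (Y : ModuleCat.{u} R) (n : ℕ) : Subsingleton (Ext A Y n) ↔ Subsingleton (Ext B Y n) :=
  ⟨fun _ ↦ Ext.subsingleton_of_retract (Retract.ofIso e.toModuleIso.symm),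
    fun _ ↦ Ext.subsingleton_of_retract (Retract.ofIso e.toModuleIso)⟩

theorem SyzygyChain.subsingleton_ext_succ_iff {M : ModuleCat.{u} R} (c : SyzygyChain R M)
    (Y : ModuleCat.{u} R) (j k : ℕ) :
    Subsingleton (Ext (c.Ω j) Y (k + 2)) ↔ Subsingleton (Ext (c.Ω (j + 1)) Y (k + 1)) := by
  obtain ⟨e⟩ := c.isoSucc j
  have := c.projective j
  have : Projective (c.P j) := (c.P j).projective_of_categoryTheory_projective
  rw [LinearEquiv.subsingleton_ext_iff (A := c.Ω (j + 1)) (B := ModuleCat.of R _) e]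
  exact (LinearMap.shortExact_shortComplexKer (c.surj j)).subsingleton_ext_succ_iff_of_projective
    Y k

theorem SyzygyChain.subsingleton_ext_iff {M : ModuleCat.{u} R} (c : SyzygyChain R M)
    (Y : ModuleCat.{u} R) (n : ℕ) :
    Subsingleton (Ext M Y (n + 1)) ↔ Subsingleton (Ext (c.Ω n) Y 1) := by
  obtain ⟨e⟩ := c.iso0
  have key (j k : ℕ) : Subsingleton (Ext (c.Ω k) Y (j + 1)) ↔
      Subsingleton (Ext (c.Ω (k + j)) Y 1) := by
    induction j generalizing k with
    | zero => rfl
    | succ j ih => rw [c.subsingleton_ext_succ_iff, ih, add_right_comm, add_assoc]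
  rw [← LinearEquiv.subsingleton_ext_iff e, key, zero_add]

theorem EmbedsIn.subsingleton_ext {X T : ModuleCat.{u} R} (h : EmbedsIn R X T)
    {Y : ModuleCat.{u} R} {n : ℕ} (hT : Subsingleton (Ext T Y n))
    (hY : ∀ Z : ModuleCat.{u} R, Subsingleton (Ext Z Y (n + 1))) :
    Subsingleton (Ext X Y n) := by
  obtain ⟨g, hg⟩ := h
  have hS : (ModuleCat.shortComplexOfCompEqZero g (LinearMap.range g).mkQ
      (LinearMap.range_mkQ_comp g)).ShortExact :=
    ModuleCat.shortComplex_shortExact _ (LinearMap.exact_map_mkQ_range g) hg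
      (Submodule.mkQ_surjective _)
  refine subsingleton_of_forall_eq 0 fun x ↦ ?_
  obtain ⟨y, rfl⟩ := Ext.contravariant_sequence_exact₁ hS Y x (add_comm 1 n)
    ((hY _).elim _ _)
  rw [hT.elim y 0, Ext.comp_zero]

theorem isSummand_of_leftInverse {A B : ModuleCat.{u} R} (i : A →ₗ[R] B) (p : B →ₗ[R] A)
    (h : p ∘ₗ i = LinearMap.id) : IsSummand R A B := by
  have hp (a : A) : p (i a) = a := LinearMap.congr_fun h a
  refine ⟨ModuleCat.of R (LinearMap.ker p), ⟨LinearEquiv.ofBijective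
    (i.coprod (LinearMap.ker p).subtype) ⟨?_, fun b ↦ ?_⟩⟩⟩
  · refine (injective_iff_map_eq_zero _).2 fun ⟨a, x, hx⟩ h0 ↦ ?_
    have h0 : i a + x = 0 := h0
    have ha : a = 0 := by simpa [hp, LinearMap.mem_ker.1 hx] using congrArg p h0
    subst ha
    simpa using h0
  · refine ⟨(p b, ⟨b - i (p b), by simp [hp]⟩), by simp⟩

theorem IsSummand.subsingleton_ext {A B : ModuleCat.{u} R} (h : IsSummand R A B)
    {Y : ModuleCat.{u} R} {n : ℕ} (hB : Subsingleton (Ext B Y n)) : Subsingleton (Ext A Y n) := by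
  obtain ⟨C, ⟨e⟩⟩ := h
  refine Ext.subsingleton_of_retract (X' := B) ⟨ModuleCat.ofHom (e ∘ₗ LinearMap.inl R A C),
    ModuleCat.ofHom (LinearMap.fst R A C ∘ₗ e.symm), ?_⟩
  ext x
  simp

theorem HasSyzygyType.exists_isSummand {M : ModuleCat.{u} R} {c : SyzygyChain R M} {s : ℕ}
    {A : Fin s → ModuleCat.{u} R} (h : HasSyzygyType R c s A) {Y : ModuleCat.{u} R} {n j : ℕ}
    (hE : ¬ Subsingleton (Ext (c.Ω j) Y n)) :
    ∃ i, IsSummand R (A i) (c.Ω j) ∧ ¬ Subsingleton (Ext (A i) Y n) := by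
  obtain ⟨m, ⟨e⟩⟩ := h.2.2.2 j
  by_contra! hA
  let p (x : Σ i, Fin (m i)) : c.Ω j →ₗ[R] A x.1 :=
    LinearMap.proj x.2 ∘ₗ LinearMap.proj x.1 ∘ₗ e.toLinearMap
  let q (x : Σ i, Fin (m i)) : A x.1 →ₗ[R] c.Ω j :=
    e.symm.toLinearMap ∘ₗ LinearMap.single R _ x.1 ∘ₗ
      LinearMap.single R (fun _ : Fin (m x.1) ↦ A x.1) x.2
  have hpq (x) : p x ∘ₗ q x = LinearMap.id := by
    ext a
    simp [p, q]
  have hqp : ∑ x, q x ∘ₗ p x = LinearMap.id := by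
    ext b
    apply e.injective
    ext i k
    simp only [LinearMap.sum_apply, map_sum, Fintype.sum_sigma, Finset.sum_apply]
    rw [Finset.sum_eq_single i, Finset.sum_eq_single k]
    · simp [p, q]
    · intro l _ hl
      simp [p, q, Pi.single_eq_of_ne' hl]
    · simp
    · intro l _ hl
      simp [p, q, Pi.single_eq_of_ne' hl]
    · simp
  refine hE (Ext.subsingleton_of_sum_comp_eq_id (fun x : Σ i, Fin (m i) ↦ A x.1)
    (fun x ↦ ModuleCat.ofHom (p x)) (fun x ↦ ModuleCat.ofHom (q x)) ?_
    fun x ↦ hA _ (isSummand_of_leftInverse _ _ (hpq x)))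
  ext b
  simpa [ModuleCat.hom_sum] using LinearMap.congr_fun hqp b

end

/-- Let `Λ` be an artinian ring with Jacobson radical `J`, let `T`
be a right `Λ`-module of finite syzygy type `s` in which `Λ/J` embeds, with
`A 1, …, A s` representing the indecomposables of the syzygy category of `T`.  Then
`l Fin dim Λ ≤ 1 + max { σ_T(Aᵢ) | Aᵢ non-projective and σ_T(Aᵢ) < ∞ }`. -/
theorem bigFinDim_le_one_add_max_contingency (Λ : Type u) [Ring Λ]
    [IsArtinianRing Λ] [IsArtinianRing Λᵐᵒᵖ]
    (T : ModuleCat.{u} Λᵐᵒᵖ) (cT : SyzygyChain Λᵐᵒᵖ T)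
    (s : ℕ) (A : Fin s → ModuleCat.{u} Λᵐᵒᵖ) (hst : HasSyzygyType Λᵐᵒᵖ cT s A)
    (hemb : EmbedsIn Λᵐᵒᵖ (radQuot Λᵐᵒᵖ) T)
    (μ : ℤ)
    (hμ : IsGreatest (insert (-1)
      {z : ℤ | ∃ i, ¬ Module.Projective Λᵐᵒᵖ ↥(A i) ∧ ContEq Λᵐᵒᵖ cT (A i) z}) μ) :
    bigFinDim Λ ≤ ((μ + 1).toNat : ℕ∞) := by
  classical
  refine sSup_le ?_
  rintro _ ⟨hd, M, rfl⟩
  have hM : ∃ n, PdimLE Λ n M := by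
    by_contra! hM
    exact hd (sInf_eq_top.2 fun _ ⟨n, _, hn⟩ ↦ (hM n hn).elim)
  obtain ⟨n, hn, hmin⟩ : ∃ n, PdimLE Λ n M ∧ ∀ k < n, ¬ PdimLE Λ k M :=
    ⟨Nat.find hM, Nat.find_spec hM, fun _ ↦ Nat.find_min hM⟩
  refine (sInf_le ⟨n, rfl, hn⟩ : pdim Λ M ≤ n).trans (Nat.cast_le.2 ?_)
  obtain _ | d := n
  · exact Nat.zero_le _
  have hT : ¬ Subsingleton (CategoryTheory.Abelian.Ext T (charDual M) (d + 1)) := fun hT ↦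
    hmin d d.lt_succ_self (hn.of_subsingleton_ext_charDual
      (hemb.subsingleton_ext hT fun Z ↦ hn.subsingleton_ext_charDual Z 0))
  rw [cT.subsingleton_ext_iff] at hT
  obtain ⟨i, hi, hiE⟩ := hst.exists_isSummand hT
  have hproj : ¬ Module.Projective Λᵐᵒᵖ (A i) := fun _ ↦ by
    have : Projective (A i) := (A i).projective_of_categoryTheory_projective
    exact hiE (subsingleton_of_forall_eq 0 CategoryTheory.Abelian.Ext.eq_zero_of_projective)
  have hcont : ContEq Λᵐᵒᵖ cT (A i) d := by
    refine ⟨Or.inr ⟨d, hi, rfl⟩, ?_⟩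
    rintro _ (rfl | ⟨j, hj, rfl⟩)
    · omega
    · by_contra! hdj
      obtain ⟨k, rfl⟩ := Nat.exists_eq_add_of_lt (Nat.cast_lt.1 hdj)
      refine hiE (IsSummand.subsingleton_ext hj ((cT.subsingleton_ext_iff _ _).1 ?_))
      rw [add_right_comm d]
      exact hn.subsingleton_ext_charDual T k
  have := hμ.2 (Or.inr ⟨i, hproj, hcont⟩)
  omega
end

section
/- In the setting below, if M is a finitely generated left Λ-module, then for each i with 1 ≤ i ≤ s, the number τ_i = dim_K Tor_1^Λ(A_i, M) is given by τ_i = dim_K(A_i ⊗_Λ M) + Σ_{j=1}^s b_{ij} · dim_K(A_j ⊗_Λ M) − Σ_{l=1}^n p_{il} · dim_K(e_l M). -/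
open CategoryTheory

universe u

section TorK

variable (K : Type u) [Field K] (Λ : Type u) [Ring Λ] [Algebra K Λ]

/-- The `K`-dimension of the balanced tensor product `A ⊗_Λ M` of a right
`Λ`-module `A` and a left `Λ`-module `M`, realized as the quotient of `A ⊗_K M`
by the balancing relations.  (The `K`-structures are the canonical ones obtained
by restriction along `algebraMap`.) -/
noncomputable def balTenDim (A M : Type u) [AddCommGroup A] [Module Λᵐᵒᵖ A]
    [AddCommGroup M] [Module Λ M] : ℕ :=
  letI : Module K A := Module.compHom A (algebraMap K Λᵐᵒᵖ)
  letI : Module K M := Module.compHom M (algebraMap K Λ)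
  Module.finrank K ((TensorProduct K A M) ⧸
    Submodule.span K {x : TensorProduct K A M | ∃ (a : A) (l : Λ) (m : M),
      x = (MulOpposite.op l • a) ⊗ₜ[K] m - a ⊗ₜ[K] (l • m)})

/-- The `K`-dimension of `Tor₁^Λ(A, ·)` computed from a projective presentation:
given a `Λ`-linear map `g : N → P` (to be used with `N = ker(P → M)` and `g` the
inclusion, for a projective cover `P → M`), this is the `K`-dimension of the kernel
of the induced map `A ⊗_Λ N → A ⊗_Λ P` on balanced tensor products. -/
noncomputable def torOneDim (A N P : Type u) [AddCommGroup A] [Module Λᵐᵒᵖ A]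
    [AddCommGroup N] [Module Λ N] [AddCommGroup P] [Module Λ P] (g : N →ₗ[Λ] P) : ℕ :=
  letI : Module K A := Module.compHom A (algebraMap K Λᵐᵒᵖ)
  letI : Module K N := Module.compHom N (algebraMap K Λ)
  letI : Module K P := Module.compHom P (algebraMap K Λ)
  Module.finrank K ↥(LinearMap.ker (Submodule.mapQ
    (Submodule.span K {x : TensorProduct K A N | ∃ (a : A) (l : Λ) (m : N),
      x = (MulOpposite.op l • a) ⊗ₜ[K] m - a ⊗ₜ[K] (l • m)})
    (Submodule.span K {x : TensorProduct K A P | ∃ (a : A) (l : Λ) (m : P),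
      x = (MulOpposite.op l • a) ⊗ₜ[K] m - a ⊗ₜ[K] (l • m)})
    (TensorProduct.map LinearMap.id
      ({ toFun := g
         map_add' := g.map_add
         map_smul' := fun k x => g.map_smul (algebraMap K Λ k) x } : N →ₗ[K] P))
    (by
      rw [← Submodule.map_le_iff_le_comap, Submodule.map_span]
      apply Submodule.span_le.2
      rintro x ⟨y, ⟨a, l, m, rfl⟩, rfl⟩
      apply Submodule.subset_span
      exact ⟨a, l, g m, by simp [map_sub, g.map_smul]⟩)))

end TorK

section Corner

variable (Λ : Type u) [Ring Λ]

/-- The right ideal `eΛ` determined by an idempotent `e`, as a right `Λ`-submodule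
(i.e. `Λᵐᵒᵖ`-submodule) of `Λ` : it consists of the elements fixed by left
multiplication by `e`. -/
def cornerSub (e : Λ) : Submodule Λᵐᵒᵖ Λ where
  carrier := {x | e * x = x}
  add_mem' := by
    intro a b ha hb
    simp only [Set.mem_setOf_eq] at *
    rw [mul_add, ha, hb]
  zero_mem' := mul_zero e
  smul_mem' := by
    intro c x hx
    simp only [Set.mem_setOf_eq] at *
    show e * (c • x) = c • x
    rw [MulOpposite.smul_eq_mul_unop, ← mul_assoc, hx]

/-- `e` is a primitive idempotent of `Λ`. -/
def IsPrimitiveIdempotent (e : Λ) : Prop :=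
  IsIdempotentElem e ∧ e ≠ 0 ∧
    ∀ f g : Λ, IsIdempotentElem f → IsIdempotentElem g → f * g = 0 → g * f = 0 →
      f + g = e → f = 0 ∨ g = 0

variable (K : Type u) [Field K] [Algebra K Λ]

/-- The `K`-dimension of `e M = {e • m | m ∈ M}` for an element `e : Λ` and a left
`Λ`-module `M`. -/
noncomputable def cornerDim (e : Λ) (M : Type u) [AddCommGroup M] [Module Λ M] : ℕ :=
  letI : Module K M := Module.compHom M (algebraMap K Λ)
  Module.finrank K ↥(LinearMap.range
    ({ toFun := fun m => e • m
       map_add' := fun x y => smul_add e x y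
       map_smul' := fun k m => by
        show e • ((algebraMap K Λ k) • m) = (algebraMap K Λ k) • (e • m)
        rw [← mul_smul, ← mul_smul, Algebra.commutes] } : M →ₗ[K] M))

end Corner

open scoped TensorProduct

section BalancedTensor

open MulOpposite

variable (K : Type*) [Field K] (Λ : Type*) [Ring Λ]

section Basic

variable (A M : Type*) [AddCommGroup A] [Module Λᵐᵒᵖ A] [Module K A]
  [AddCommGroup M] [Module Λ M] [Module K M]

/-- The balancing relations `(a l) ⊗ m - a ⊗ (l m)` in `A ⊗_K M`. -/
def balRel : Submodule K (A ⊗[K] M) :=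
  Submodule.span K {x : TensorProduct K A M | ∃ (a : A) (l : Λ) (m : M),
      x = (MulOpposite.op l • a) ⊗ₜ[K] m - a ⊗ₜ[K] (l • m)}

/-- The balanced tensor product `A ⊗_Λ M`. -/
abbrev BalTensor : Type _ := (A ⊗[K] M) ⧸ balRel K Λ A M

variable {A M}

/-- The pure tensor of `a` and `m` in `A ⊗_Λ M`. -/
def balTmul (a : A) (m : M) : BalTensor K Λ A M := (balRel K Λ A M).mkQ (a ⊗ₜ m)

lemma balTmul_smul (a : A) (l : Λ) (m : M) :
    balTmul K Λ (op l • a) m = balTmul K Λ a (l • m) := by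
  rw [← sub_eq_zero, balTmul, balTmul, ← map_sub, Submodule.mkQ_apply,
    Submodule.Quotient.mk_eq_zero]
  exact Submodule.subset_span ⟨a, l, m, rfl⟩

lemma balTmul_sum_left {ι : Type*} (t : Finset ι) (a : ι → A) (m : M) :
    balTmul K Λ (∑ i ∈ t, a i) m = ∑ i ∈ t, balTmul K Λ (a i) m := by
  simp [balTmul, TensorProduct.sum_tmul]

lemma balTmul_sum_right {ι : Type*} (t : Finset ι) (a : A) (m : ι → M) :
    balTmul K Λ a (∑ i ∈ t, m i) = ∑ i ∈ t, balTmul K Λ a (m i) := by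
  simp [balTmul, TensorProduct.tmul_sum]

variable {K Λ} in
lemma BalTensor.induction {p : BalTensor K Λ A M → Prop}
    (tmul : ∀ a m, p (balTmul K Λ a m)) (add : ∀ x y, p x → p y → p (x + y))
    (x : BalTensor K Λ A M) : p x := by
  obtain ⟨y, rfl⟩ := (balRel K Λ A M).mkQ_surjective x
  induction y with
  | zero => simpa [balTmul] using tmul 0 0
  | tmul a m => exact tmul a m
  | add y z hy hz => rw [map_add]; exact add _ _ hy hz

/-- A balanced `K`-bilinear map induces a `K`-linear map on `A ⊗_Λ M`. -/
def balLift {V : Type*} [AddCommGroup V] [Module K V] (f : A →ₗ[K] M →ₗ[K] V)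
    (hf : ∀ a (l : Λ) m, f (op l • a) m = f a (l • m)) : BalTensor K Λ A M →ₗ[K] V :=
  (balRel K Λ A M).liftQ (TensorProduct.lift f) <| Submodule.span_le.2 <| by
    rintro _ ⟨a, l, m, rfl⟩
    simp [hf]

@[simp]
lemma balLift_tmul {V : Type*} [AddCommGroup V] [Module K V] (f : A →ₗ[K] M →ₗ[K] V)
    (hf : ∀ a (l : Λ) m, f (op l • a) m = f a (l • m)) (a : A) (m : M) :
    balLift K Λ f hf (balTmul K Λ a m) = f a m := by
  rfl

end Basic

section Functoriality

variable [Algebra K Λ] {A A' A'' M M' M'' : Type*}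
  [AddCommGroup A] [Module Λᵐᵒᵖ A] [Module K A] [IsScalarTower K Λᵐᵒᵖ A]
  [AddCommGroup A'] [Module Λᵐᵒᵖ A'] [Module K A'] [IsScalarTower K Λᵐᵒᵖ A']
  [AddCommGroup A''] [Module Λᵐᵒᵖ A''] [Module K A''] [IsScalarTower K Λᵐᵒᵖ A'']
  [AddCommGroup M] [Module Λ M] [Module K M] [IsScalarTower K Λ M]
  [AddCommGroup M'] [Module Λ M'] [Module K M'] [IsScalarTower K Λ M']
  [AddCommGroup M''] [Module Λ M''] [Module K M''] [IsScalarTower K Λ M'']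

lemma balRel_le_comap (f : A →ₗ[Λᵐᵒᵖ] A') (g : M →ₗ[Λ] M') :
    balRel K Λ A M ≤ (balRel K Λ A' M').comap
      (TensorProduct.map (f.restrictScalars K) (g.restrictScalars K)) := by
  rw [balRel, Submodule.span_le]
  rintro _ ⟨a, l, m, rfl⟩
  exact Submodule.subset_span ⟨f a, l, g m, by simp⟩

/-- Functoriality of the balanced tensor product. -/
def balMap (f : A →ₗ[Λᵐᵒᵖ] A') (g : M →ₗ[Λ] M') :
    BalTensor K Λ A M →ₗ[K] BalTensor K Λ A' M' :=
  Submodule.mapQ _ _ (TensorProduct.map (f.restrictScalars K) (g.restrictScalars K))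
    (balRel_le_comap K Λ f g)

@[simp]
lemma balMap_tmul (f : A →ₗ[Λᵐᵒᵖ] A') (g : M →ₗ[Λ] M') (a : A) (m : M) :
    balMap K Λ f g (balTmul K Λ a m) = balTmul K Λ (f a) (g m) := rfl

lemma balMap_comp (f : A →ₗ[Λᵐᵒᵖ] A') (g : M →ₗ[Λ] M') (f' : A' →ₗ[Λᵐᵒᵖ] A'')
    (g' : M' →ₗ[Λ] M'') :
    balMap K Λ f' g' ∘ₗ balMap K Λ f g = balMap K Λ (f' ∘ₗ f) (g' ∘ₗ g) := by
  refine LinearMap.ext fun x => ?_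
  induction x using BalTensor.induction with
  | tmul a m => rfl
  | add x y hx hy => simp only [map_add, hx, hy]

lemma balMap_id :
    balMap K Λ (LinearMap.id : A →ₗ[Λᵐᵒᵖ] A) (LinearMap.id : M →ₗ[Λ] M) = LinearMap.id := by
  refine LinearMap.ext fun x => ?_
  induction x using BalTensor.induction with
  | tmul a m => rfl
  | add x y hx hy => rw [map_add, hx, hy, map_add]

lemma finrank_balTensor_congr (f : A ≃ₗ[Λᵐᵒᵖ] A') :
    Module.finrank K (BalTensor K Λ A M) = Module.finrank K (BalTensor K Λ A' M) :=
  LinearEquiv.finrank_eq (LinearEquiv.ofLinearMap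
    (balMap K Λ f.toLinearMap LinearMap.id) (balMap K Λ f.symm.toLinearMap LinearMap.id)
    (by rw [balMap_comp, f.comp_symm, LinearMap.comp_id, balMap_id])
    (by rw [balMap_comp, f.symm_comp, LinearMap.comp_id, balMap_id]))

lemma exact_mapQ {U V W : Type*} [AddCommGroup U] [Module K U] [AddCommGroup V] [Module K V]
    [AddCommGroup W] [Module K W] {f : U →ₗ[K] V} {g : V →ₗ[K] W}
    {p : Submodule K U} {q : Submodule K V} {r : Submodule K W}
    (hf : p ≤ q.comap f) (hg : q ≤ r.comap g) (hr : r ≤ q.map g) (h : Function.Exact f g) :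
    Function.Exact (Submodule.mapQ p q f hf) (Submodule.mapQ q r g hg) := by
  intro y
  obtain ⟨y, rfl⟩ := q.mkQ_surjective y
  constructor
  · intro hy
    simp only [Submodule.mkQ_apply, Submodule.mapQ_apply, Submodule.Quotient.mk_eq_zero] at hy
    obtain ⟨z, hz, hzy⟩ := hr hy
    obtain ⟨x, hx⟩ := (h (y - z)).1 (by rw [map_sub, hzy, sub_self])
    refine ⟨p.mkQ x, ?_⟩
    simp only [Submodule.mkQ_apply, Submodule.mapQ_apply, hx]
    rw [Submodule.Quotient.eq]
    simpa using hz
  · rintro ⟨x, hx⟩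
    obtain ⟨x, rfl⟩ := p.mkQ_surjective x
    rw [← hx]
    simp [h.apply_apply_eq_zero x]

variable {K Λ}

lemma balMap_surjective {f : A →ₗ[Λᵐᵒᵖ] A'} {g : M →ₗ[Λ] M'} (hf : Function.Surjective f)
    (hg : Function.Surjective g) : Function.Surjective (balMap K Λ f g) := by
  intro x
  induction x using BalTensor.induction with
  | tmul a m =>
    obtain ⟨a, rfl⟩ := hf a
    obtain ⟨m, rfl⟩ := hg m
    exact ⟨balTmul K Λ a m, rfl⟩
  | add x y hx hy =>
    obtain ⟨x, rfl⟩ := hx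
    obtain ⟨y, rfl⟩ := hy
    exact ⟨x + y, map_add _ _ _⟩

lemma balRel_le_map {f : A →ₗ[Λᵐᵒᵖ] A'} {g : M →ₗ[Λ] M'} (hf : Function.Surjective f)
    (hg : Function.Surjective g) : balRel K Λ A' M' ≤ (balRel K Λ A M).map
      (TensorProduct.map (f.restrictScalars K) (g.restrictScalars K)) := by
  rw [balRel, Submodule.span_le]
  rintro _ ⟨a, l, m, rfl⟩
  obtain ⟨a, rfl⟩ := hf a
  obtain ⟨m, rfl⟩ := hg m
  exact ⟨_, Submodule.subset_span ⟨a, l, m, rfl⟩, by simp⟩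

lemma balMap_exact_left {f : A →ₗ[Λᵐᵒᵖ] A'} {g : A' →ₗ[Λᵐᵒᵖ] A''} (h : Function.Exact f g)
    (hg : Function.Surjective g) :
    Function.Exact (balMap K Λ f (LinearMap.id : M →ₗ[Λ] M))
      (balMap K Λ g (LinearMap.id : M →ₗ[Λ] M)) :=
  exact_mapQ K _ _ (balRel_le_map hg Function.surjective_id)
    (rTensor_exact M (f := f.restrictScalars K) (g := g.restrictScalars K) h hg)

lemma balMap_exact_right {f : M →ₗ[Λ] M'} {g : M' →ₗ[Λ] M''} (h : Function.Exact f g)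
    (hg : Function.Surjective g) :
    Function.Exact (balMap K Λ (LinearMap.id : A →ₗ[Λᵐᵒᵖ] A) f)
      (balMap K Λ (LinearMap.id : A →ₗ[Λᵐᵒᵖ] A) g) :=
  exact_mapQ K _ _ (balRel_le_map Function.surjective_id hg)
    (lTensor_exact A (f := f.restrictScalars K) (g := g.restrictScalars K) h hg)

variable (K M) in
/-- The map `A ⊗_Λ M → M` induced by a functional on the right module `A`. -/
def balContractLeft (f : A →ₗ[Λᵐᵒᵖ] Λ) : BalTensor K Λ A M →ₗ[K] M :=
  balLift K Λ (LinearMap.mk₂ K (fun a m => f a • m) (by simp [add_smul])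
    (fun c a m => by
      rw [← smul_assoc, ← LinearMap.restrictScalars_apply K f, map_smul]; rfl)
    (by simp)
    (fun c a m => by
      rw [← algebraMap_smul Λ c m, ← algebraMap_smul Λ c (f a • m), smul_smul, smul_smul,
        Algebra.commutes]))
    (by simp [mul_smul])

@[simp]
lemma balContractLeft_tmul (f : A →ₗ[Λᵐᵒᵖ] Λ) (a : A) (m : M) :
    balContractLeft K M f (balTmul K Λ a m) = f a • m := rfl

variable (K A) in
/-- The map `A ⊗_Λ M → A` induced by a functional on the left module `M`. -/
def balContractRight (f : M →ₗ[Λ] Λ) : BalTensor K Λ A M →ₗ[K] A :=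
  balLift K Λ (LinearMap.mk₂ K (fun a m => op (f m) • a) (by simp)
    (fun c a m => by
      rw [← algebraMap_smul Λᵐᵒᵖ c a, ← algebraMap_smul Λᵐᵒᵖ c (op (f m) • a), smul_smul,
        smul_smul, Algebra.commutes])
    (by simp [add_smul])
    (fun c a m => by
      rw [← smul_assoc, ← LinearMap.restrictScalars_apply K f, map_smul]; rfl))
    (by simp [mul_smul])

@[simp]
lemma balContractRight_tmul (f : M →ₗ[Λ] Λ) (a : A) (m : M) :
    balContractRight K A f (balTmul K Λ a m) = op (f m) • a := rfl

lemma sum_balTmul_balContractLeft {ι : Type*} [Fintype ι] {a : ι → A} {f : ι → A →ₗ[Λᵐᵒᵖ] Λ}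
    (h : ∀ x, ∑ k, op (f k x) • a k = x) (x : BalTensor K Λ A M) :
    ∑ k, balTmul K Λ (a k) (balContractLeft K M (f k) x) = x := by
  induction x using BalTensor.induction with
  | tmul b m =>
    simp only [balContractLeft_tmul, ← balTmul_smul, ← balTmul_sum_left, h]
  | add x y hx hy =>
    nth_rw 2 [← hx, ← hy]
    simp [balTmul, TensorProduct.tmul_add, Finset.sum_add_distrib]

lemma sum_balTmul_balContractRight {ι : Type*} [Fintype ι] {b : ι → M} {f : ι → M →ₗ[Λ] Λ}
    (h : ∀ x, ∑ k, f k x • b k = x) (x : BalTensor K Λ A M) :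
    ∑ k, balTmul K Λ (balContractRight K A (f k) x) (b k) = x := by
  induction x using BalTensor.induction with
  | tmul b m =>
    simp only [balContractRight_tmul, balTmul_smul, ← balTmul_sum_right, h]
  | add x y hx hy =>
    nth_rw 2 [← hx, ← hy]
    simp [balTmul, TensorProduct.add_tmul, Finset.sum_add_distrib]

lemma balContractLeft_balMap (f : A →ₗ[Λᵐᵒᵖ] Λ) (g : M →ₗ[Λ] M') (x : BalTensor K Λ A M) :
    balContractLeft K M' f (balMap K Λ LinearMap.id g x) = g (balContractLeft K M f x) := by
  induction x using BalTensor.induction with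
  | tmul a m => simp
  | add x y hx hy => simp only [map_add, hx, hy]

lemma balContractRight_balMap (f : M →ₗ[Λ] Λ) (g : A →ₗ[Λᵐᵒᵖ] A') (x : BalTensor K Λ A M) :
    balContractRight K A' f (balMap K Λ g LinearMap.id x) = g (balContractRight K A f x) := by
  induction x using BalTensor.induction with
  | tmul a m => simp
  | add x y hx hy => simp only [map_add, hx, hy]

lemma exists_dual_basis_left (R : Type*) [Ring R] (Q : Type*) [AddCommGroup Q] [Module R Q]
    [Module.Finite R Q] [Module.Projective R Q] :
    ∃ (n : ℕ) (b : Fin n → Q) (f : Fin n → Q →ₗ[R] R), ∀ x, ∑ k, f k x • b k = x := by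
  obtain ⟨n, π, hπ⟩ := Module.Finite.exists_fin' R Q
  obtain ⟨σ, hσ⟩ := Module.projective_lifting_property π LinearMap.id hπ
  refine ⟨n, fun k => π (Pi.single k 1), fun k => LinearMap.proj k ∘ₗ σ, fun x => ?_⟩
  conv_rhs => rw [← LinearMap.id_apply (R := R) x, ← hσ, LinearMap.comp_apply,
    pi_eq_sum_univ' (σ x)]
  simp

lemma exists_dual_basis_right (Λ : Type*) [Ring Λ] (Q : Type*) [AddCommGroup Q] [Module Λᵐᵒᵖ Q]
    [Module.Finite Λᵐᵒᵖ Q] [Module.Projective Λᵐᵒᵖ Q] :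
    ∃ (n : ℕ) (b : Fin n → Q) (f : Fin n → Q →ₗ[Λᵐᵒᵖ] Λ), ∀ x, ∑ k, op (f k x) • b k = x := by
  obtain ⟨n, b, f, h⟩ := exists_dual_basis_left Λᵐᵒᵖ Q
  let u : Λᵐᵒᵖ →ₗ[Λᵐᵒᵖ] Λ := 
    { toFun := unop, map_add' := fun _ _ => rfl, map_smul' := fun _ _ => rfl }
  exact ⟨n, b, fun k => u ∘ₗ f k, h⟩

lemma balMap_injective_of_projective_left [Module.Finite Λᵐᵒᵖ A] [Module.Projective Λᵐᵒᵖ A]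
    {g : M →ₗ[Λ] M'} (hg : Function.Injective g) :
    Function.Injective (balMap K Λ (LinearMap.id : A →ₗ[Λᵐᵒᵖ] A) g) := by
  obtain ⟨n, b, f, h⟩ := exists_dual_basis_right Λ A
  intro x y hxy
  rw [← sum_balTmul_balContractLeft h x, ← sum_balTmul_balContractLeft h y]
  refine Finset.sum_congr rfl fun k _ => congrArg _ (hg ?_)
  rw [← balContractLeft_balMap, hxy, balContractLeft_balMap]

lemma balMap_injective_of_projective_right [Module.Finite Λ M] [Module.Projective Λ M]
    {g : A →ₗ[Λᵐᵒᵖ] A'} (hg : Function.Injective g) :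
    Function.Injective (balMap K Λ g (LinearMap.id : M →ₗ[Λ] M)) := by
  obtain ⟨n, b, f, h⟩ := exists_dual_basis_left Λ M
  intro x y hxy
  rw [← sum_balTmul_balContractRight h x, ← sum_balTmul_balContractRight h y]
  refine Finset.sum_congr rfl fun k _ => congrArg (balTmul K Λ · _) (hg ?_)
  rw [← balContractRight_balMap, hxy, balContractRight_balMap]

lemma finrank_range_add_finrank_of_exact {U V W : Type*} [AddCommGroup U] [Module K U]
    [AddCommGroup V] [Module K V] [FiniteDimensional K V] [AddCommGroup W] [Module K W]
    {f : U →ₗ[K] V} {g : V →ₗ[K] W} (h : Function.Exact f g) (hg : Function.Surjective g) :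
    Module.finrank K (LinearMap.range f) + Module.finrank K W = Module.finrank K V := by
  rw [← g.finrank_range_add_finrank_ker, LinearMap.range_eq_top.2 hg, finrank_top,
    h.linearMap_ker_eq, add_comm]

/-- Balance of `Tor₁`, in terms of dimensions. -/
lemma finrank_ker_balMap_add {X Q N P : Type*}
    [AddCommGroup X] [Module Λᵐᵒᵖ X] [Module K X] [IsScalarTower K Λᵐᵒᵖ X]
    [AddCommGroup Q] [Module Λᵐᵒᵖ Q] [Module K Q] [IsScalarTower K Λᵐᵒᵖ Q]
    [AddCommGroup N] [Module Λ N] [Module K N] [IsScalarTower K Λ N]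
    [AddCommGroup P] [Module Λ P] [Module K P] [IsScalarTower K Λ P]
    [Module.Finite Λᵐᵒᵖ Q] [Module.Projective Λᵐᵒᵖ Q]
    [Module.Finite Λ P] [Module.Projective Λ P] [FiniteDimensional K Q] [FiniteDimensional K P]
    {i : X →ₗ[Λᵐᵒᵖ] Q} {p : Q →ₗ[Λᵐᵒᵖ] A} {g : N →ₗ[Λ] P} {q : P →ₗ[Λ] M}
    (hi : Function.Injective i) (hip : Function.Exact i p) (hp : Function.Surjective p)
    (hg : Function.Injective g) (hgq : Function.Exact g q) (hq : Function.Surjective q) :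
    Module.finrank K (LinearMap.ker (balMap K Λ (LinearMap.id : A →ₗ[Λᵐᵒᵖ] A) g)) +
      Module.finrank K (BalTensor K Λ Q M) =
    Module.finrank K (BalTensor K Λ A M) + Module.finrank K (BalTensor K Λ X M) := by
  have : FiniteDimensional K A :=
    Module.Finite.of_surjective (p.restrictScalars K) hp
  have : FiniteDimensional K X :=
    Module.Finite.of_injective (i.restrictScalars K) hi
  have : FiniteDimensional K N :=
    Module.Finite.of_injective (g.restrictScalars K) hg
  have h₁ := (balMap K Λ (LinearMap.id : A →ₗ[Λᵐᵒᵖ] A) g).finrank_range_add_finrank_ker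
  have h₂ := finrank_range_add_finrank_of_exact (balMap_exact_right (K := K) (A := A) hgq hq)
    (balMap_surjective Function.surjective_id hq)
  have h₃ := finrank_range_add_finrank_of_exact (balMap_exact_right (K := K) (A := Q) hgq hq)
    (balMap_surjective Function.surjective_id hq)
  have h₄ := finrank_range_add_finrank_of_exact (balMap_exact_left (K := K) (M := P) hip hp)
    (balMap_surjective hp Function.surjective_id)
  have h₅ := finrank_range_add_finrank_of_exact (balMap_exact_left (K := K) (M := N) hip hp)
    (balMap_surjective hp Function.surjective_id)
  have h₆ := finrank_range_add_finrank_of_exact (balMap_exact_right (K := K) (A := X) hgq hq)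
    (balMap_surjective Function.surjective_id hq)
  have hQ := balMap_injective_of_projective_left (K := K) (A := Q) hg
  have hP := balMap_injective_of_projective_right (K := K) (M := P) hi
  have h₇ := LinearMap.finrank_range_of_inj hQ
  have h₈ := LinearMap.finrank_range_of_inj hP
  have h₉ : Module.finrank K (LinearMap.range (balMap K Λ i (LinearMap.id : N →ₗ[Λ] N))) =
      Module.finrank K (LinearMap.range (balMap K Λ (LinearMap.id : X →ₗ[Λᵐᵒᵖ] X) g)) := by
    rw [(Submodule.equivMapOfInjective _ hQ _).finrank_eq,
      (Submodule.equivMapOfInjective _ hP _).finrank_eq, ← LinearMap.range_comp, ← LinearMap.range_comp, balMap_comp, balMap_comp]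
    rfl
  omega

lemma finrank_balTensor_pi {ι : Type*} [Fintype ι] (C : ι → Type*)
    [∀ i, AddCommGroup (C i)] [∀ i, Module Λᵐᵒᵖ (C i)] [∀ i, Module K (C i)]
    [∀ i, IsScalarTower K Λᵐᵒᵖ (C i)] [∀ i, FiniteDimensional K (C i)] [FiniteDimensional K M] :
    Module.finrank K (BalTensor K Λ (∀ i, C i) M) =
      ∑ i, Module.finrank K (BalTensor K Λ (C i) M) := by
  classical
  rw [← Module.finrank_pi_fintype]
  refine LinearEquiv.finrank_eq (LinearEquiv.ofLinearMap
    (LinearMap.pi fun i => balMap K Λ (LinearMap.proj i) LinearMap.id)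
    (∑ i, balMap K Λ (LinearMap.single Λᵐᵒᵖ C i) LinearMap.id ∘ₗ LinearMap.proj i) ?_ ?_)
  · refine LinearMap.pi_ext' fun i => LinearMap.ext fun x => ?_
    induction x using BalTensor.induction with
    | tmul a m =>
      have h : (∑ i, balMap K Λ (LinearMap.single Λᵐᵒᵖ C i) LinearMap.id ∘ₗ LinearMap.proj i)
          (Pi.single i (balTmul K Λ a m)) = balTmul K Λ (Pi.single i a) m := by
        rw [LinearMap.sum_apply, Finset.sum_eq_single i]
        · simp
        · intro j _ hj
          simp [Pi.single_eq_of_ne hj]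
        · simp
      ext j
      simp only [LinearMap.comp_apply, LinearMap.coe_single, h, LinearMap.id_apply,
        LinearMap.pi_apply, balMap_tmul, LinearMap.proj_apply]
      obtain rfl | hj := eq_or_ne j i
      · simp
      · simp [Pi.single_eq_of_ne hj, balTmul]
    | add x y hx hy => rw [map_add, hx, hy, map_add]
  · refine LinearMap.ext fun x => ?_
    induction x using BalTensor.induction with
    | tmul a m =>
      simp [← balTmul_sum_left, Finset.univ_sum_single]
    | add x y hx hy => rw [map_add, hx, hy, map_add]

lemma finrank_balTensor_cornerSub {e : Λ} (he : IsIdempotentElem e) {f : M →ₗ[K] M}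
    (hf : ∀ m, f m = e • m) :
    Module.finrank K (BalTensor K Λ (cornerSub Λ e) M) =
      Module.finrank K (LinearMap.range f) := by
  let ι : cornerSub Λ e →ₗ[Λᵐᵒᵖ] Λ := (cornerSub Λ e).subtype
  let e' : cornerSub Λ e := ⟨e, he⟩
  have hdual (x : BalTensor K Λ (cornerSub Λ e) M) :
      balTmul K Λ e' (balContractLeft K M ι x) = x := by
    simpa using sum_balTmul_balContractLeft (ι := Unit) (a := fun _ => e') (f := fun _ => ι)
      (fun x => by simpa using Subtype.ext (show e * (x : Λ) = x from x.2)) x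
  have hinj : Function.Injective (balContractLeft K M ι) :=
    Function.LeftInverse.injective hdual
  have hrange : LinearMap.range (balContractLeft K M ι) = LinearMap.range f := by
    apply le_antisymm
    · rintro _ ⟨x, rfl⟩
      refine ⟨balContractLeft K M ι x, ?_⟩
      rw [hf]
      nth_rw 2 [← hdual x]
      rfl
    · rintro _ ⟨m, rfl⟩
      exact ⟨balTmul K Λ e' m, (hf m).symm⟩
  rw [← LinearMap.finrank_range_of_inj hinj, hrange]

lemma eq_compHom_algebraMap {R V : Type*} [Ring R] [Algebra K R] [AddCommGroup V] [Module R V]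
    (inst : Module K V) [IsScalarTower K R V] : inst = Module.compHom V (algebraMap K R) :=
  Module.ext' _ _ fun c v => (algebraMap_smul R c v).symm

instance finiteDimensional_cornerSub [FiniteDimensional K Λ] (e : Λ) :
    FiniteDimensional K (cornerSub Λ e) :=
  Module.Finite.of_injective ((cornerSub Λ e).subtype.restrictScalars K)
    (Submodule.subtype_injective _)

end Functoriality

section Bridge

universe v

variable {K : Type v} [Field K] {Λ : Type v} [Ring Λ] [Algebra K Λ] (A M : Type v)
  [AddCommGroup A] [Module Λᵐᵒᵖ A] [instA : Module K A] [towerA : IsScalarTower K Λᵐᵒᵖ A]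
  [AddCommGroup M] [Module Λ M] [instM : Module K M] [towerM : IsScalarTower K Λ M]

lemma balTenDim_eq : balTenDim K Λ A M = Module.finrank K (BalTensor K Λ A M) := by
  obtain rfl := eq_compHom_algebraMap (R := Λᵐᵒᵖ) instA
  obtain rfl := eq_compHom_algebraMap (R := Λ) instM
  rfl

lemma torOneDim_eq {N : Type v} [AddCommGroup N] [Module Λ N] [instN : Module K N]
    [towerN : IsScalarTower K Λ N] (g : N →ₗ[Λ] M) :
    torOneDim K Λ A N M g =
      Module.finrank K (LinearMap.ker (balMap K Λ (LinearMap.id : A →ₗ[Λᵐᵒᵖ] A) g)) := by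
  obtain rfl := eq_compHom_algebraMap (R := Λᵐᵒᵖ) instA
  obtain rfl := eq_compHom_algebraMap (R := Λ) instM
  obtain rfl := eq_compHom_algebraMap (R := Λ) instN
  rfl

lemma cornerDim_eq {e : Λ} (he : IsIdempotentElem e) :
    cornerDim Λ K e M = Module.finrank K (BalTensor K Λ (cornerSub Λ e) M) := by
  obtain rfl := eq_compHom_algebraMap (R := Λ) instM
  let _ : Module K M := Module.compHom M (algebraMap K Λ)
  exact (finrank_balTensor_cornerSub he (fun _ => rfl)).symm

end Bridge

end BalancedTensor

/-- In the setting of Statement 11, for a finitely generated left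
`Λ`-module `M` and `e 1, …, e n` a full set of orthogonal primitive idempotents of
`Λ` with `P i = projective cover of A i ≅ ⊕_l (e_l Λ)^(p i l)` :
`τᵢ = dim_K(Aᵢ ⊗_Λ M) + Σⱼ B i j ⬝ dim_K(Aⱼ ⊗_Λ M) − Σ_l p i l ⬝ dim_K(e_l M)`. -/
theorem tor_dim_formula (K : Type u) [Field K] (Λ : Type u) [Ring Λ]
    [Algebra K Λ] [FiniteDimensional K Λ]
    (T : ModuleCat.{u} Λᵐᵒᵖ) (hT : Module.Finite Λᵐᵒᵖ ↥T)
    (cT : SyzygyChain Λᵐᵒᵖ T)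
    (s : ℕ) (A : Fin s → ModuleCat.{u} Λᵐᵒᵖ) (hst : HasSyzygyType Λᵐᵒᵖ cT s A)
    (hemb : EmbedsIn Λᵐᵒᵖ (radQuot Λᵐᵒᵖ) T)
    (cA : ∀ i, SyzygyChain Λᵐᵒᵖ (A i))
    (B : Matrix (Fin s) (Fin s) ℕ)
    (hB : ∀ i, Nonempty (↥((cA i).Ω 1) ≃ₗ[Λᵐᵒᵖ] ((j : Fin s) → Fin (B i j) → ↥(A j))))
    (n : ℕ) (e : Fin n → Λ)
    (he₁ : ∀ l, IsPrimitiveIdempotent Λ (e l))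
    (he₂ : ∀ l l', l ≠ l' → e l * e l' = 0)
    (he₃ : ∑ l, e l = 1)
    (p : Fin s → Fin n → ℕ)
    (hp : ∀ i, Nonempty (↥((cA i).P 0) ≃ₗ[Λᵐᵒᵖ]
      ((l : Fin n) → Fin (p i l) → ↥(cornerSub Λ (e l)))))
    (M : ModuleCat.{u} Λ) (hM : Module.Finite Λ ↥M)
    (τ : Fin s → ℕ)
    (hτ : ∀ (i : Fin s) (P : ModuleCat.{u} Λ) (q : ↥P →ₗ[Λ] ↥M),
      Module.Projective Λ ↥P → Function.Surjective q →
        torOneDim K Λ ↥(A i) ↥(LinearMap.ker q) ↥P (LinearMap.ker q).subtype = τ i) :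
    ∀ i, (τ i : ℤ) =
      (balTenDim K Λ ↥(A i) ↥M : ℤ) + ∑ j, (B i j : ℤ) * (balTenDim K Λ ↥(A j) ↥M : ℤ)
        - ∑ l, (p i l : ℤ) * (cornerDim Λ K (e l) ↥M : ℤ) := by
  intro i
  let instA (j) : Module K ↥(A j) := Module.compHom _ (algebraMap K Λᵐᵒᵖ)
  let instM : Module K ↥M := Module.compHom _ (algebraMap K Λ)
  let instQ : Module K ↥((cA i).P 0) := Module.compHom _ (algebraMap K Λᵐᵒᵖ)
  let instX : Module K ↥((cA i).Ω 1) := Module.compHom _ (algebraMap K Λᵐᵒᵖ)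
  have towerA (j) : IsScalarTower K Λᵐᵒᵖ ↥(A j) := .of_algebraMap_smul fun _ _ => rfl
  have towerM : IsScalarTower K Λ ↥M := .of_algebraMap_smul fun _ _ => rfl
  have towerQ : IsScalarTower K Λᵐᵒᵖ ↥((cA i).P 0) := .of_algebraMap_smul fun _ _ => rfl
  have towerX : IsScalarTower K Λᵐᵒᵖ ↥((cA i).Ω 1) := .of_algebraMap_smul fun _ _ => rfl
  have finM : FiniteDimensional K ↥M := Module.Finite.trans Λ ↥M
  have finA (j) : FiniteDimensional K ↥(A j) := by
    obtain ⟨φ⟩ := hp j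
    obtain ⟨ψ⟩ := (cA j).iso0
    exact Module.Finite.of_surjective
      ((ψ.toLinearMap ∘ₗ (cA j).f 0 ∘ₗ φ.symm.toLinearMap).restrictScalars K)
      (ψ.surjective.comp (((cA j).surj 0).comp φ.symm.surjective))
  obtain ⟨φ⟩ := hp i
  obtain ⟨ψ⟩ := (cA i).iso0
  obtain ⟨χ⟩ := (cA i).isoSucc 0
  obtain ⟨ω⟩ := hB i
  have finQ : FiniteDimensional K ↥((cA i).P 0) :=
    Module.Finite.of_surjective (φ.symm.toLinearMap.restrictScalars K) φ.symm.surjective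
  have finQ' : Module.Finite Λᵐᵒᵖ ↥((cA i).P 0) := .of_restrictScalars_finite K Λᵐᵒᵖ _
  have projQ := (cA i).projective 0
  obtain ⟨m, q, hq⟩ := Module.Finite.exists_fin' Λ ↥M
  have htor := hτ i (ModuleCat.of Λ (Fin m → Λ)) q inferInstance hq
  have key := finrank_ker_balMap_add (K := K)
    (i := (LinearMap.ker ((cA i).f 0)).subtype ∘ₗ χ.toLinearMap)
    (p := ψ.toLinearMap ∘ₗ (cA i).f 0) (g := (LinearMap.ker q).subtype) (q := q)
    ((Submodule.subtype_injective _).comp χ.injective)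
    (by
      rw [LinearMap.exact_iff, LinearEquiv.ker_comp, LinearEquiv.range_comp,
        Submodule.range_subtype])
    (ψ.surjective.comp ((cA i).surj 0)) (Submodule.subtype_injective _)
    (LinearMap.exact_subtype_ker_map q) hq
  rw [← torOneDim_eq, htor, finrank_balTensor_congr K Λ φ, finrank_balTensor_pi] at key
  rw [finrank_balTensor_congr K Λ ω, finrank_balTensor_pi] at key
  simp only [finrank_balTensor_pi, Finset.sum_const, Finset.card_univ, Fintype.card_fin,
    smul_eq_mul] at key
  simp only [← cornerDim_eq _ (he₁ _).1] at key
  simp only [← balTenDim_eq] at key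
  have key' := congrArg (Nat.cast (R := ℤ)) key
  push_cast at key'
  linarith
end
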